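/- arXiv:1506.08547 — 6 statements merged into one kernel-verified Lean document; each statement's English description precedes it below -/
import Mathlib

section
/- Let ∼ be a symmetric relation on a finite set F and let ≼_π be a total order on F. Then every word W over F can be transformed, by a finite sequence of valid swaps (each replacing an adjacent pair ⋯fg⋯ by ⋯gf⋯ where f ≇ g), into a π-stable word. -/
open scoped Classical

noncomputable section

namespace LLLFormal

/-- A walk: an initial state together with a list of (flaw, next-state) steps. -/
structure Walk (Ω F : Type*) where
  start : Ω
  steps : List (F × Ω)

variable {Ω F : Type*}

/-- Validity of a list of steps from a given state, w.r.t. a step relation. -/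
def ValidFrom (step : F → Ω → Ω → Prop) : Ω → List (F × Ω) → Prop
  | _, [] => True
  | σ, (f, σ') :: rest => step f σ σ' ∧ ValidFrom step σ' rest

/-- The state reached after performing the steps `l` starting from `σ`. -/
def endOf (σ : Ω) (l : List (F × Ω)) : Ω := (l.map Prod.snd).getLastD σ

/-- `τ` is a (valid) walk w.r.t. the step relation `step`. -/
def Walk.Valid (step : F → Ω → Ω → Prop) (τ : Walk Ω F) : Prop := ValidFrom step τ.start τ.steps

/-- The flaw word of a walk. -/
def Walk.word (τ : Walk Ω F) : List F := τ.steps.map Prod.fst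

/-- The final state of a walk. -/
def Walk.final (τ : Walk Ω F) : Ω := endOf τ.start τ.steps

/-- The length of a walk. -/
def Walk.len (τ : Walk Ω F) : ℕ := τ.steps.length

/-- Product of the transition probabilities along a list of steps. -/
def prodRho (ρ : F → Ω → Ω → ℝ) : Ω → List (F × Ω) → ℝ
  | _, [] => 1
  | σ, (f, σ') :: rest => ρ f σ σ' * prodRho ρ σ' rest

/-- The weight `p(τ)` of a walk. -/
def Walk.wt (ωinit : Ω → ℝ) (ρ : F → Ω → Ω → ℝ) (τ : Walk Ω F) : ℝ :=
  ωinit τ.start * prodRho ρ τ.start τ.steps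

/-- `λ_W = ∏_i λ_{w_i}`. -/
def wordWt (lam : F → ℝ) (W : List F) : ℝ := (W.map lam).prod

/-- The data of the objects, flaws, actions and resampling oracles:
`mem f σ` means `σ ∈ f`; `Act f σ` is the action set `A(f,σ)`;
`ρ f σ σ'` is the probability `ρ(σ'|f,σ)`, whose support is exactly `A(f,σ)`. -/
structure Setup (Ω F : Type*) [Fintype Ω] where
  mem : F → Ω → Prop
  flaw_nonempty : ∀ f, ∃ σ, mem f σ
  Act : F → Ω → Set Ω
  act_nonempty : ∀ f σ, mem f σ → (Act f σ).Nonempty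
  ρ : F → Ω → Ω → ℝ
  ρ_nonneg : ∀ f σ σ', 0 ≤ ρ f σ σ'
  ρ_support : ∀ f σ, mem f σ → ∀ σ', (0 < ρ f σ σ' ↔ σ' ∈ Act f σ)
  ρ_total : ∀ f σ, mem f σ → ∑ σ' : Ω, ρ f σ σ' = 1

variable [Fintype Ω]

/-- A valid step `σ →^f σ'`. -/
def Setup.step (S : Setup Ω F) (f : F) (σ σ' : Ω) : Prop := S.mem f σ ∧ σ' ∈ S.Act f σ

/-- A probability distribution on `Ω`. -/
def IsProb (ω : Ω → ℝ) : Prop := (∀ σ, 0 ≤ ω σ) ∧ ∑ σ : Ω, ω σ = 1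

/-- A probability distribution on `Ω` with full support. -/
def IsPosProb (ω : Ω → ℝ) : Prop := (∀ σ, 0 < ω σ) ∧ ∑ σ : Ω, ω σ = 1

/-- `γ^init = max_{σ∈Ω} ωinit σ / ω σ`. -/
def gammaInit [Nonempty Ω] (ωinit ω : Ω → ℝ) : ℝ :=
  Finset.univ.sup' Finset.univ_nonempty fun σ => ωinit σ / ω σ

/-- Condition (A): `λ_f ≥ ∑_{σ ∈ f : σ' ∈ A(f,σ)} ρ(σ'|f,σ) ω(σ)/ω(σ')`. -/
def CondA (S : Setup Ω F) (ω : Ω → ℝ) (lam : F → ℝ) : Prop :=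
  ∀ (f : F) (σ' : Ω),
    lam f ≥ ∑ σ : Ω, if S.mem f σ ∧ σ' ∈ S.Act f σ then S.ρ f σ σ' * ω σ / ω σ' else 0

/-- `(F, ∼)` is a potential causality graph:
for every valid step `σ →^f σ'`, `F_{σ'} ⊆ (F_σ − {f}) ∪ Γ(f)`. -/
def Causality (S : Setup Ω F) (sim : F → F → Prop) : Prop :=
  ∀ f σ σ', S.step f σ σ' → ∀ g, S.mem g σ' → (S.mem g σ ∧ g ≠ f) ∨ sim f g

/-- A finite set of flaws is independent. -/
def IndepF (sim : F → F → Prop) (I : Finset F) : Prop :=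
  ∀ f ∈ I, ∀ g ∈ I, f ≠ g → ¬ sim f g

/-- `B` is a partition of the word `W` into consecutive nonempty blocks of distinct,
pairwise non-neighbouring flaws, with each block contained in `Γ⁺` of the previous one. -/
def StablePartition (sim : F → F → Prop) (B : List (List F)) (W : List F) : Prop :=
  W = B.flatten ∧
  (∀ b ∈ B, b ≠ [] ∧ b.Nodup ∧ b.Pairwise fun f g => ¬ sim f g) ∧
  B.Chain' fun b₁ b₂ => ∀ g ∈ b₂, ∃ f ∈ b₁, f = g ∨ sim f g

/-- A stable word. -/
def StableWord (sim : F → F → Prop) (W : List F) : Prop := ∃ B, StablePartition sim B W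

/-- A stable partition whose blocks are listed in strictly increasing order. -/
def PiStablePartition [LinearOrder F] (sim : F → F → Prop) (B : List (List F))
    (W : List F) : Prop :=
  StablePartition sim B W ∧ ∀ b ∈ B, b.Chain' (· < ·)

/-- A π-stable word. -/
def PiStableWord [LinearOrder F] (sim : F → F → Prop) (W : List F) : Prop :=
  ∃ B, PiStablePartition sim B W

/-- A deterministic strategy: it assigns to every walk whose final state is flawed
a flaw present in the final state. -/
def IsStrategy (S : Setup Ω F) (Λ : Walk Ω F → F) : Prop :=
  ∀ τ : Walk Ω F, Walk.Valid S.step τ → (∃ f, S.mem f (Walk.final τ)) →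
    S.mem (Λ τ) (Walk.final τ)

/-- A walk follows the strategy `Λ`. -/
def Follows (Λ : Walk Ω F → F) (τ : Walk Ω F) : Prop :=
  ∀ (i : ℕ) (h : i < τ.steps.length),
    (τ.steps.get ⟨i, h⟩).1 = Λ ⟨τ.start, τ.steps.take i⟩

/-- The set `Bad(t)` of bad `t`-trajectories. -/
def Bad (S : Setup Ω F) (Λ : Walk Ω F → F) (ωinit : Ω → ℝ) (t : ℕ) : Set (Walk Ω F) :=
  {τ | Walk.Valid S.step τ ∧ Walk.len τ = t ∧ Follows Λ τ ∧ 0 < ωinit τ.start}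

/-- The cluster-expansion condition:
`(λ_f/μ_f) ∑_{S ∈ Ind(Γ(f))} μ(S) ≤ θ` for every flaw `f`. -/
def ClusterCond [Fintype F] (sim : F → F → Prop) (lam μ : F → ℝ) (θ : ℝ) : Prop :=
  ∀ f : F,
    lam f / μ f *
      ∑ I ∈ Finset.univ.filter (fun I : Finset F => (∀ g ∈ I, sim f g) ∧ IndepF sim I),
        ∏ g ∈ I, μ g ≤ θ

/-- `τ` is a prefix of `τ'`. -/
def Walk.IsPrefix (τ τ' : Walk Ω F) : Prop := τ.start = τ'.start ∧ τ.steps <+: τ'.steps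

/-- A valid set of walks: all walks follow one common deterministic strategy,
and no walk is a proper prefix of another one. -/
def ValidSet (S : Setup Ω F) (X : Set (Walk Ω F)) : Prop :=
  (∀ τ ∈ X, Walk.Valid S.step τ) ∧
  (∃ Λ : Walk Ω F → F, IsStrategy S Λ ∧ ∀ τ ∈ X, Follows Λ τ) ∧
  ∀ τ ∈ X, ∀ τ' ∈ X, Walk.IsPrefix τ τ' → τ = τ'

/-- Atomicity of the resampling oracles. -/
def Atomic (S : Setup Ω F) : Prop :=
  ∀ f σ' σ₁ σ₂, S.step f σ₁ σ' → S.step f σ₂ σ' → σ₁ = σ₂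

/-- The map `swap` sends every swappable pair of steps to a valid pair of steps. -/
def SwapValid (S : Setup Ω F) (sim : F → F → Prop) (swap : Ω → F → Ω → F → Ω → Ω) : Prop :=
  ∀ σ₁ f σ₂ g σ₃, S.step f σ₁ σ₂ → S.step g σ₂ σ₃ → ¬ sim f g →
    S.step g σ₁ (swap σ₁ f σ₂ g σ₃) ∧ S.step f (swap σ₁ f σ₂ g σ₃) σ₃

/-- The map `swap` is injective (as a map of two-step walks). -/
def SwapInj (S : Setup Ω F) (sim : F → F → Prop) (swap : Ω → F → Ω → F → Ω → Ω) : Prop :=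
  ∀ σ₁ f σ₂ τ₂ g σ₃, S.step f σ₁ σ₂ → S.step g σ₂ σ₃ → S.step f σ₁ τ₂ → S.step g τ₂ σ₃ →
    ¬ sim f g → swap σ₁ f σ₂ g σ₃ = swap σ₁ f τ₂ g σ₃ → σ₂ = τ₂

/-- The map `swap` preserves the product of the two transition probabilities. -/
def SwapProb (S : Setup Ω F) (sim : F → F → Prop) (swap : Ω → F → Ω → F → Ω → Ω) : Prop :=
  ∀ σ₁ f σ₂ g σ₃, S.step f σ₁ σ₂ → S.step g σ₂ σ₃ → ¬ sim f g →
    S.ρ f σ₁ σ₂ * S.ρ g σ₂ σ₃ =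
      S.ρ g σ₁ (swap σ₁ f σ₂ g σ₃) * S.ρ f (swap σ₁ f σ₂ g σ₃) σ₃

/-- `(ρ, ∼)` is weakly commutative. -/
def WeakComm (S : Setup Ω F) (sim : F → F → Prop) : Prop :=
  ∃ swap, SwapValid S sim swap ∧ SwapInj S sim swap

/-- `(ρ, ∼)` is strongly commutative. -/
def StrongComm (S : Setup Ω F) (sim : F → F → Prop) : Prop :=
  ∃ swap, SwapValid S sim swap ∧ SwapInj S sim swap ∧ SwapProb S sim swap

/-- One valid swap transforming the walk `τ` into the walk `τ'`. -/
def SwapStep (S : Setup Ω F) (sim : F → F → Prop) (swap : Ω → F → Ω → F → Ω → Ω)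
    (τ τ' : Walk Ω F) : Prop :=
  ∃ (A B : List (F × Ω)) (f g : F) (σ₂ σ₃ : Ω),
    f ≠ g ∧ ¬ sim f g ∧
    S.step f (endOf τ.start A) σ₂ ∧ S.step g σ₂ σ₃ ∧
    τ.steps = A ++ (f, σ₂) :: (g, σ₃) :: B ∧
    τ' = ⟨τ.start, A ++ (g, swap (endOf τ.start A) f σ₂ g σ₃) :: (f, σ₃) :: B⟩

/-- `U` is a chain of the walk `τ`. -/
def IsChainOf (sim : F → F → Prop) (U : List F) (τ : Walk Ω F) : Prop :=
  U.Sublist (Walk.word τ) ∧ U.Chain' fun a b => a = b ∨ sim a b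

/-- The longest prefix of `W` ending with `f` (empty if `f` does not occur in `W`). -/
def prefEnd (f : F) (W : List F) : List F :=
  (W.reverse.dropWhile fun x => decide (x ≠ f)).reverse

/-- `W^f_τ` for `f ∈ F ∪ {∅}`. -/
def prefOpt (fo : Option F) (W : List F) : List F :=
  match fo with
  | none => W
  | some f => prefEnd f W

/-- `g ∈ Γ⁺(I)` for a list `I` of flaws. -/
def GammaPlusL (sim : F → F → Prop) (I : List F) (g : F) : Prop := ∃ f ∈ I, f = g ∨ sim f g

/-- The steps of one round, starting at state `σ` with already-addressed flaws `I`: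
each addressed flaw `f` satisfies `f ∈ F_σ − Γ⁺(I)` and the step is valid. -/
def RoundFrom (S : Setup Ω F) (sim : F → F → Prop) : Ω → List F → List (F × Ω) → Prop
  | _, _, [] => True
  | σ, I, (f, σ') :: rest =>
      S.mem f σ ∧ ¬ GammaPlusL sim I f ∧ σ' ∈ S.Act f σ ∧
      RoundFrom S sim σ' (I ++ [f]) rest

/-- Like `RoundFrom`, but the addressed flaw is moreover the `≼`-least of `F_σ − Γ⁺(I)`. -/
def RoundFromPi [LinearOrder F] (S : Setup Ω F) (sim : F → F → Prop) :
    Ω → List F → List (F × Ω) → Prop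
  | _, _, [] => True
  | σ, I, (f, σ') :: rest =>
      S.mem f σ ∧ ¬ GammaPlusL sim I f ∧
      (∀ g, S.mem g σ → ¬ GammaPlusL sim I g → f ≤ g) ∧
      σ' ∈ S.Act f σ ∧ RoundFromPi S sim σ' (I ++ [f]) rest

/-- A walk grouped into rounds: each round is valid, and at the final state of every
round except possibly the last one, `F_σ − Γ⁺(I_r) = ∅`. -/
def RoundsFrom (S : Setup Ω F) (sim : F → F → Prop) : Ω → List (List (F × Ω)) → Prop
  | _, [] => True
  | σ, b :: rest =>
      RoundFrom S sim σ [] b ∧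
      (rest = [] ∨
        ((∀ g, S.mem g (endOf σ b) → GammaPlusL sim (b.map Prod.fst) g) ∧
          RoundsFrom S sim (endOf σ b) rest))

/-- Like `RoundsFrom`, with the `≼`-least flaw selection rule. -/
def RoundsFromPi [LinearOrder F] (S : Setup Ω F) (sim : F → F → Prop) :
    Ω → List (List (F × Ω)) → Prop
  | _, [] => True
  | σ, b :: rest =>
      RoundFromPi S sim σ [] b ∧
      (rest = [] ∨
        ((∀ g, S.mem g (endOf σ b) → GammaPlusL sim (b.map Prod.fst) g) ∧
          RoundsFromPi S sim (endOf σ b) rest))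

/-- The family `Ind^init = ∪_{σ : ωinit σ > 0} Ind(F_σ)`. -/
def indInitSets [Fintype F] (S : Setup Ω F) (sim : F → F → Prop) (ωinit : Ω → ℝ) :
    Finset (Finset F) :=
  Finset.univ.filter fun R => IndepF sim R ∧ ∃ σ, 0 < ωinit σ ∧ ∀ f ∈ R, S.mem f σ

/-- `λ_φ` for a sequence of sets of flaws. -/
def seqWt (lam : F → ℝ) (φ : List (Finset F)) : ℝ := (φ.map fun I => ∏ f ∈ I, lam f).prod

/-- `|φ| = ∑_r |I_r|`. -/
def seqSize (φ : List (Finset F)) : ℕ := (φ.map Finset.card).sum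

/-- A strongly stable sequence. -/
def StronglyStableSeq (sim : F → F → Prop) (φ : List (Finset F)) : Prop :=
  φ ≠ [] ∧ (∀ I ∈ φ, IndepF sim I) ∧
  φ.Chain' (fun I J => ∀ g ∈ J, ∃ f ∈ I, sim f g) ∧
  ∀ I ∈ φ.tail, I ≠ ∅

/-- Membership in `Stab(R,S,t,ℓ)`. -/
def StabRSTL (sim : F → F → Prop) (R S : Finset F) (t ℓ : ℕ) (φ : List (Finset F)) : Prop :=
  φ.head? = some R ∧ φ.length ≤ ℓ ∧ t ≤ seqSize φ ∧
  ((φ.length = 1 ∧ S = ∅) ∨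
    (2 ≤ φ.length ∧ S = φ.tail.headI.filter (fun g => ¬ ∃ f ∈ R, sim f g) ∧
      StronglyStableSeq sim φ.tail))

/-- One valid swap on words. -/
def WordSwap (sim : F → F → Prop) (W W' : List F) : Prop :=
  ∃ (A B : List F) (f g : F), f ≠ g ∧ ¬ sim f g ∧ W = A ++ f :: g :: B ∧ W' = A ++ g :: f :: B

end LLLFormal

namespace LLLFormal

section FoataNormalForm

variable {F : Type*} {sim : F → F → Prop}

/-- Swaps may be performed inside any surrounding word. -/
theorem reflTransGen_wordSwap_append_append {U V : List F}
    (h : Relation.ReflTransGen (WordSwap sim) U V) (A B : List F) :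
    Relation.ReflTransGen (WordSwap sim) (A ++ U ++ B) (A ++ V ++ B) := by
  refine h.lift (fun X => A ++ X ++ B) ?_
  rintro _ _ ⟨C, D, f, g, hne, hsim, rfl, rfl⟩
  exact ⟨A ++ C, D ++ B, f, g, hne, hsim, by simp, by simp⟩

/-- A letter moves to the front past all letters that commute with it. -/
theorem reflTransGen_wordSwap_append_singleton {f : F} {U : List F}
    (h : ∀ x ∈ U, ¬ (x = f ∨ sim x f)) :
    Relation.ReflTransGen (WordSwap sim) (U ++ [f]) (f :: U) := by
  induction U with
  | nil => exact .refl
  | cons a t ih =>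
    have hat := ih fun x hx => h x (List.mem_cons_of_mem _ hx)
    have ha := h a List.mem_cons_self
    rw [not_or] at ha
    have hlift := reflTransGen_wordSwap_append_append hat [a] []
    simp only [List.append_nil, List.singleton_append] at hlift
    exact hlift.tail ⟨[], t, a, f, ha.1, ha.2, rfl, rfl⟩

variable [LinearOrder F]

/-- A letter commuting with a sorted independent block can be sorted into it by swaps. -/
theorem exists_sorted_insert (hsym : Symmetric sim) {f : F} {b : List F}
    (hb : b.Pairwise fun x y => x < y ∧ ¬ sim x y) (h : ∀ x ∈ b, ¬ (x = f ∨ sim x f)) :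
    ∃ b' : List F, (∀ x, x ∈ b' ↔ x = f ∨ x ∈ b) ∧
      (b'.Pairwise fun x y => x < y ∧ ¬ sim x y) ∧
      Relation.ReflTransGen (WordSwap sim) (f :: b) b' := by
  induction b with
  | nil => exact ⟨[f], by simp, by simp, .refl⟩
  | cons a t ih =>
    obtain ⟨hat, ht⟩ := List.pairwise_cons.1 hb
    have ha := h a List.mem_cons_self
    rw [not_or] at ha
    have htf : ∀ x ∈ t, ¬ (x = f ∨ sim x f) := fun x hx => h x (List.mem_cons_of_mem _ hx)
    rcases lt_or_gt_of_ne ha.1 with haf | hfa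
    · obtain ⟨t', hmem, ht', hswap⟩ := ih ht htf
      refine ⟨a :: t', ?_, ?_, ?_⟩
      · intro x
        simp only [List.mem_cons, hmem]
        tauto
      · refine List.pairwise_cons.2 ⟨fun x hx => ?_, ht'⟩
        rcases (hmem x).1 hx with rfl | hx
        · exact ⟨haf, ha.2⟩
        · exact hat x hx
      · have hlift := reflTransGen_wordSwap_append_append hswap [a] []
        simp only [List.append_nil, List.singleton_append] at hlift
        exact .head ⟨[], t, f, a, Ne.symm ha.1, fun hs => ha.2 (hsym hs), rfl, rfl⟩ hlift
    · refine ⟨f :: a :: t, by simp, List.pairwise_cons.2 ⟨fun x hx => ⟨?_, ?_⟩, hb⟩, .refl⟩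
      · rcases List.mem_cons.1 hx with rfl | hx
        · exact hfa
        · exact hfa.trans (hat x hx).1
      · exact fun hs => h x hx (.inr (hsym hs))

/-- A list of sorted independent blocks, each covered by the neighbourhood of the previous one. -/
def FoataBlocks (sim : F → F → Prop) (B : List (List F)) : Prop :=
  (∀ b ∈ B, b ≠ [] ∧ b.Pairwise fun x y => x < y ∧ ¬ sim x y) ∧
    B.IsChain fun b c => ∀ g ∈ c, ∃ f ∈ b, f = g ∨ sim f g

theorem FoataBlocks.piStableWord_flatten {B : List (List F)} (hB : FoataBlocks sim B) :
    PiStableWord sim B.flatten := by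
  refine ⟨B, ⟨rfl, fun b hb => ⟨(hB.1 b hb).1, ?_, ?_⟩, hB.2⟩, fun b hb => ?_⟩
  · exact (hB.1 b hb).2.imp fun h => h.1.ne
  · exact (hB.1 b hb).2.imp fun h => h.2
  · exact ((hB.1 b hb).2.imp fun h => h.1).isChain

theorem foataBlocks_cons {b : List F} {B : List (List F)} :
    FoataBlocks sim (b :: B) ↔
      (b ≠ [] ∧ b.Pairwise fun x y => x < y ∧ ¬ sim x y) ∧
      (∀ c ∈ B.head?, ∀ g ∈ c, ∃ f ∈ b, f = g ∨ sim f g) ∧ FoataBlocks sim B := by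
  simp only [FoataBlocks, List.forall_mem_cons, List.isChain_cons]
  tauto

/-- A letter commuting with all blocks can be put into the first one. -/
theorem FoataBlocks.exists_insert_head (hsym : Symmetric sim) {f : F} {B : List (List F)}
    (hB : FoataBlocks sim B) (h : ∀ x ∈ B.flatten, ¬ (x = f ∨ sim x f)) :
    ∃ B' : List (List F), FoataBlocks sim B' ∧
      (∀ c ∈ B'.head?, ∀ g ∈ c, g = f ∨ ∃ b ∈ B.head?, g ∈ b) ∧
      Relation.ReflTransGen (WordSwap sim) (f :: B.flatten) B'.flatten := by
  cases B with
  | nil => exact ⟨[[f]], by simp [FoataBlocks], by simp, .refl⟩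
  | cons b C =>
    obtain ⟨⟨-, hb⟩, hbC, hC⟩ := foataBlocks_cons.1 hB
    obtain ⟨b', hmem, hb', hswap⟩ := exists_sorted_insert hsym hb
      fun x hx => h x (by simp [hx])
    refine ⟨b' :: C, foataBlocks_cons.2 ⟨⟨?_, hb'⟩, ?_, hC⟩, ?_, ?_⟩
    · exact List.ne_nil_of_mem ((hmem f).2 (.inl rfl))
    · intro c hc g hg
      obtain ⟨x, hx, hxg⟩ := hbC c hc g hg
      exact ⟨x, (hmem x).2 (.inr hx), hxg⟩
    · simp [hmem]
    · simpa using reflTransGen_wordSwap_append_append hswap [] C.flatten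

/-- A letter not commuting with some letter of the blocks can be appended by swaps
without changing the first block. -/
theorem FoataBlocks.exists_append_of_dependent (hsym : Symmetric sim) {f : F}
    {B : List (List F)} (hB : FoataBlocks sim B) (h : ∃ x ∈ B.flatten, x = f ∨ sim x f) :
    ∃ B' : List (List F), FoataBlocks sim B' ∧ B'.head? = B.head? ∧
      Relation.ReflTransGen (WordSwap sim) (B.flatten ++ [f]) B'.flatten := by
  induction B with
  | nil => simp at h
  | cons b C ih =>
    obtain ⟨hb, hbC, hC⟩ := foataBlocks_cons.1 hB
    by_cases hdep : ∃ x ∈ C.flatten, x = f ∨ sim x f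
    · obtain ⟨C', hC', hhead, hswap⟩ := ih hC hdep
      refine ⟨b :: C', foataBlocks_cons.2 ⟨hb, hhead ▸ hbC, hC'⟩, rfl, ?_⟩
      simpa using reflTransGen_wordSwap_append_append hswap b []
    · have hindep : ∀ x ∈ C.flatten, ¬ (x = f ∨ sim x f) :=
        fun x hx hxf => hdep ⟨x, hx, hxf⟩
      obtain ⟨C', hC', hhead, hswap⟩ := hC.exists_insert_head hsym hindep
      refine ⟨b :: C', foataBlocks_cons.2 ⟨hb, ?_, hC'⟩, rfl, ?_⟩
      · intro c hc g hg
        rcases hhead c hc g hg with rfl | ⟨d, hd, hgd⟩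
        · obtain ⟨x, hx, hxg⟩ := h
          rw [List.flatten_cons, List.mem_append] at hx
          exact ⟨x, hx.resolve_right fun hx => hindep x hx hxg, hxg⟩
        · exact hbC d hd g hgd
      · simpa using reflTransGen_wordSwap_append_append
          ((reflTransGen_wordSwap_append_singleton hindep).trans hswap) b []

theorem exists_foataBlocks (hsym : Symmetric sim) (W : List F) :
    ∃ B : List (List F), FoataBlocks sim B ∧
      Relation.ReflTransGen (WordSwap sim) W B.flatten := by
  induction W using List.reverseRecOn with
  | nil => exact ⟨[], by simp [FoataBlocks], .refl⟩
  | append_singleton W f ih =>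
    obtain ⟨B, hB, hswap⟩ := ih
    have happend := reflTransGen_wordSwap_append_append hswap [] [f]
    simp only [List.nil_append] at happend
    by_cases hdep : ∃ x ∈ B.flatten, x = f ∨ sim x f
    · obtain ⟨B', hB', -, hswap'⟩ := hB.exists_append_of_dependent hsym hdep
      exact ⟨B', hB', happend.trans hswap'⟩
    · have hindep : ∀ x ∈ B.flatten, ¬ (x = f ∨ sim x f) :=
        fun x hx hxf => hdep ⟨x, hx, hxf⟩
      obtain ⟨B', hB', -, hswap'⟩ := hB.exists_insert_head hsym hindep
      exact ⟨B', hB', happend.trans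
        ((reflTransGen_wordSwap_append_singleton hindep).trans hswap')⟩

end FoataNormalForm

/-- every word over `F` can be transformed into a π-stable word by a finite
sequence of valid swaps of adjacent letters `f, g` with `f ≇ g`. -/
theorem stmt_11 {F : Type*} [Fintype F] [LinearOrder F]
    (sim : F → F → Prop) (hsym : Symmetric sim) (W : List F) :
    ∃ W' : List F, Relation.ReflTransGen (WordSwap sim) W W' ∧ PiStableWord sim W' := by
  obtain ⟨B, hB, hswap⟩ := exists_foataBlocks hsym W
  exact ⟨B.flatten, hswap, hB.piStableWord_flatten⟩

end LLLFormal
end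
end

section
/- Assume ρ is atomic and (ρ,∼) is weakly commutative. If two walks τ and τ' both follow the same deterministic strategy Λ and τ ≡ τ' (one is obtained from the other by a finite sequence of valid swaps), then τ = τ'. -/
open scoped Classical

noncomputable section

namespace LLLFormal

/-- `w` is the flaw word of some valid walk from `σ` to `e`. -/
def Reach {Ω F : Type*} (step : F → Ω → Ω → Prop) : Ω → List F → Ω → Prop
  | σ, [], e => σ = e
  | σ, f :: w, e => ∃ σ', step f σ σ' ∧ Reach step σ' w e

theorem endOf_cons {Ω F : Type*} (σ : Ω) (x : F × Ω) (l : List (F × Ω)) :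
    endOf σ (x :: l) = endOf x.2 l := by
  simp only [endOf, List.map_cons, List.getLastD_cons]

theorem endOf_append {Ω F : Type*} (σ : Ω) (A B : List (F × Ω)) :
    endOf σ (A ++ B) = endOf (endOf σ A) B := by
  induction A generalizing σ with
  | nil => rfl
  | cons x A ih => simp only [List.cons_append, endOf_cons, ih]

theorem ValidFrom.reach {Ω F : Type*} {step : F → Ω → Ω → Prop} {σ : Ω} {l : List (F × Ω)}
    (h : ValidFrom step σ l) : Reach step σ (l.map Prod.fst) (endOf σ l) := by
  induction l generalizing σ with
  | nil => rfl
  | cons x l ih =>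
    rw [endOf_cons]
    exact ⟨x.2, h.1, ih h.2⟩

/-- Under atomicity, the flaw word and the final state of a walk determine its start. -/
theorem Atomic.reach_unique {Ω F : Type*} [Fintype Ω] {S : Setup Ω F} (hS : Atomic S)
    {w : List F} {σ₁ σ₂ e : Ω} (h₁ : Reach S.step σ₁ w e) (h₂ : Reach S.step σ₂ w e) :
    σ₁ = σ₂ := by
  induction w generalizing σ₁ σ₂ with
  | nil => exact h₁.trans h₂.symm
  | cons f w ih =>
    obtain ⟨x, hx, hxw⟩ := h₁
    obtain ⟨y, hy, hyw⟩ := h₂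
    obtain rfl := ih hxw hyw
    exact hS f x σ₁ σ₂ hx hy

theorem WordSwap.symm {F : Type*} {sim : F → F → Prop} (hsym : Symmetric sim) {u v : List F}
    (h : WordSwap sim u v) : WordSwap sim v u := by
  obtain ⟨A, B, f, g, hne, hns, hu, hv⟩ := h
  exact ⟨A, B, g, f, hne.symm, fun h => hns (hsym h), hv, hu⟩

theorem WordSwap.reach {Ω F : Type*} [Fintype Ω] {S : Setup Ω F} {sim : F → F → Prop}
    {swap : Ω → F → Ω → F → Ω → Ω} (hsv : SwapValid S sim swap) {u v : List F}
    (h : WordSwap sim u v) {σ e : Ω} (hu : Reach S.step σ u e) : Reach S.step σ v e := by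
  obtain ⟨A, B, f, g, -, hns, rfl, rfl⟩ := h
  induction A generalizing σ with
  | nil =>
    obtain ⟨x, hx, y, hy, hB⟩ := hu
    obtain ⟨h₁, h₂⟩ := hsv σ f x g y hx hy hns
    exact ⟨_, h₁, y, h₂, hB⟩
  | cons a A ih =>
    obtain ⟨x, hx, hA⟩ := hu
    exact ⟨x, hx, ih hA⟩

theorem reach_iff_of_eqvGen_wordSwap {Ω F : Type*} [Fintype Ω] {S : Setup Ω F}
    {sim : F → F → Prop} (hsym : Symmetric sim) {swap : Ω → F → Ω → F → Ω → Ω}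
    (hsv : SwapValid S sim swap) {u v : List F} (h : Relation.EqvGen (WordSwap sim) u v)
    (σ e : Ω) : Reach S.step σ u e ↔ Reach S.step σ v e := by
  induction h with
  | rel u v h => exact ⟨h.reach hsv, (h.symm hsym).reach hsv⟩
  | refl => rfl
  | symm _ _ _ ih => exact ih.symm
  | trans _ _ _ _ _ ih₁ ih₂ => exact ih₁.trans ih₂

theorem WordSwap.erase {F : Type*} {sim : F → F → Prop} {u v : List F}
    (h : WordSwap sim u v) (a : F) :
    Relation.EqvGen (WordSwap sim) (u.erase a) (v.erase a) := by
  obtain ⟨A, B, f, g, hne, hns, rfl, rfl⟩ := h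
  by_cases hA : a ∈ A
  · rw [List.erase_append_left _ hA, List.erase_append_left _ hA]
    exact .rel _ _ ⟨_, B, f, g, hne, hns, rfl, rfl⟩
  rw [List.erase_append_right _ hA, List.erase_append_right _ hA]
  by_cases hf : f = a
  · subst hf
    rw [List.erase_cons_head, List.erase_cons_tail (by simpa using hne.symm),
      List.erase_cons_head]
    exact .refl _
  by_cases hg : g = a
  · subst hg
    rw [List.erase_cons_head, List.erase_cons_tail (by simpa using hne),
      List.erase_cons_head]
    exact .refl _
  refine .rel _ _ ⟨A, B.erase a, f, g, hne, hns, ?_, ?_⟩ <;>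
    simp [List.erase_cons_tail, hf, hg]

theorem eqvGen_wordSwap_erase {F : Type*} {sim : F → F → Prop} {u v : List F}
    (h : Relation.EqvGen (WordSwap sim) u v) (a : F) :
    Relation.EqvGen (WordSwap sim) (u.erase a) (v.erase a) := by
  induction h with
  | rel _ _ h => exact h.erase a
  | refl => exact .refl _
  | symm _ _ _ ih => exact .symm _ _ ih
  | trans _ _ _ _ _ ih₁ ih₂ => exact .trans _ _ _ ih₁ ih₂

theorem eqvGen_wordSwap_of_cons {F : Type*} {sim : F → F → Prop} {a : F} {u v : List F}
    (h : Relation.EqvGen (WordSwap sim) (a :: u) (a :: v)) :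
    Relation.EqvGen (WordSwap sim) u v := by
  simpa using eqvGen_wordSwap_erase h a

theorem length_eq_of_eqvGen_wordSwap {F : Type*} {sim : F → F → Prop} {u v : List F}
    (h : Relation.EqvGen (WordSwap sim) u v) : u.length = v.length := by
  induction h with
  | rel _ _ h =>
    obtain ⟨A, B, f, g, -, -, rfl, rfl⟩ := h
    simp
  | refl => rfl
  | symm _ _ _ ih => exact ih.symm
  | trans _ _ _ _ _ ih₁ ih₂ => exact ih₁.trans ih₂

theorem SwapStep.invariants {Ω F : Type*} [Fintype Ω] {S : Setup Ω F} {sim : F → F → Prop}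
    {swap : Ω → F → Ω → F → Ω → Ω} {τ τ' : Walk Ω F} (h : SwapStep S sim swap τ τ') :
    τ.start = τ'.start ∧ τ.final = τ'.final ∧ WordSwap sim τ.word τ'.word := by
  obtain ⟨A, B, f, g, σ₂, σ₃, hne, hns, -, -, hτ, rfl⟩ := h
  refine ⟨rfl, ?_, A.map Prod.fst, B.map Prod.fst, f, g, hne, hns, ?_, ?_⟩
  · simp only [Walk.final, hτ, endOf_append, endOf_cons]
  · simp [Walk.word, hτ]
  · simp [Walk.word]

theorem eqvGen_swapStep_invariants {Ω F : Type*} [Fintype Ω] {S : Setup Ω F}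
    {sim : F → F → Prop} {swap : Ω → F → Ω → F → Ω → Ω} {τ τ' : Walk Ω F}
    (h : Relation.EqvGen (SwapStep S sim swap) τ τ') :
    τ.start = τ'.start ∧ τ.final = τ'.final ∧
      Relation.EqvGen (WordSwap sim) τ.word τ'.word := by
  induction h with
  | rel _ _ h =>
    obtain ⟨h₁, h₂, h₃⟩ := h.invariants
    exact ⟨h₁, h₂, .rel _ _ h₃⟩
  | refl => exact ⟨rfl, rfl, .refl _⟩
  | symm _ _ _ ih => exact ⟨ih.1.symm, ih.2.1.symm, .symm _ _ ih.2.2⟩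
  | trans _ _ _ _ _ ih₁ ih₂ =>
    exact ⟨ih₁.1.trans ih₂.1, ih₁.2.1.trans ih₂.2.1, .trans _ _ _ ih₁.2.2 ih₂.2.2⟩

/-- Two valid continuations of a common prefix `P` chosen by the same strategy coincide as soon
as they have the same final state and trace-equivalent flaw words. -/
theorem eq_of_follows_of_eqvGen_wordSwap {Ω F : Type*} [Fintype Ω] {S : Setup Ω F}
    {sim : F → F → Prop} (hsym : Symmetric sim) (hatomic : Atomic S)
    {swap : Ω → F → Ω → F → Ω → Ω} (hsv : SwapValid S sim swap) (Λ : Walk Ω F → F) (s : Ω)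
    {l l' P : List (F × Ω)} {σ : Ω}
    (hl : ValidFrom S.step σ l) (hl' : ValidFrom S.step σ l')
    (hfol : ∀ (i : ℕ) (h : i < l.length), (l.get ⟨i, h⟩).1 = Λ ⟨s, P ++ l.take i⟩)
    (hfol' : ∀ (i : ℕ) (h : i < l'.length), (l'.get ⟨i, h⟩).1 = Λ ⟨s, P ++ l'.take i⟩)
    (hend : endOf σ l = endOf σ l')
    (hw : Relation.EqvGen (WordSwap sim) (l.map Prod.fst) (l'.map Prod.fst)) : l = l' := by
  induction l generalizing l' P σ with
  | nil =>
    have := length_eq_of_eqvGen_wordSwap hw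
    simp only [List.length_map, List.length_nil] at this
    exact (List.length_eq_zero_iff.mp this.symm).symm
  | cons x r ih =>
    cases l' with
    | nil => simpa using length_eq_of_eqvGen_wordSwap hw
    | cons y r' =>
      obtain ⟨f, σ₁⟩ := x
      obtain ⟨g, σ₂⟩ := y
      obtain rfl : f = g := by
        have h := hfol 0 (by simp)
        have h' := hfol' 0 (by simp)
        simp only [List.take_zero] at h h'
        exact h.trans h'.symm
      simp only [endOf_cons] at hend
      have hw' := eqvGen_wordSwap_of_cons hw
      have hr := (reach_iff_of_eqvGen_wordSwap hsym hsv hw' _ _).mp hl.2.reach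
      rw [hend] at hr
      obtain rfl := hatomic.reach_unique hr hl'.2.reach
      rw [ih (P := P ++ [(f, σ₁)]) hl.2 hl'.2 ?_ ?_ hend hw']
      · intro i h
        simpa using hfol (i + 1) (by simpa using h)
      · intro i h
        simpa using hfol' (i + 1) (by simpa using h)

/-- if `ρ` is atomic and `(ρ,∼)` is weakly commutative (witnessed by
`swap`), then two walks following the same deterministic strategy that are related by a
finite sequence of valid swaps are equal. -/
theorem stmt_12 {Ω F : Type*} [Fintype Ω]
    (S : Setup Ω F) (sim : F → F → Prop) (hsym : Symmetric sim)
    (hatomic : Atomic S)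
    (swap : Ω → F → Ω → F → Ω → Ω)
    (hsv : SwapValid S sim swap) (hsi : SwapInj S sim swap)
    (Λ : Walk Ω F → F) (hΛ : IsStrategy S Λ)
    (τ τ' : Walk Ω F) (hτ : Walk.Valid S.step τ) (hτ' : Walk.Valid S.step τ')
    (hfol : Follows Λ τ) (hfol' : Follows Λ τ')
    (hequiv : Relation.EqvGen (SwapStep S sim swap) τ τ') :
    τ = τ' := by
  obtain ⟨s, l⟩ := τ
  obtain ⟨s', l'⟩ := τ'
  obtain ⟨hs, hend, hw⟩ := eqvGen_swapStep_invariants hequiv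
  obtain rfl : s = s' := hs
  congr 1
  exact eq_of_follows_of_eqvGen_wordSwap hsym hatomic hsv Λ s (P := []) hτ hτ' hfol hfol' hend hw

end LLLFormal
end
end

section
/- Suppose (F,∼) is a potential causality graph. Let W ∈ Stab_π with block partition W = W_1⋯W_s and block flaw sets (I_1,…,I_s). Then I_{r+1} ⊆ Γ(I_r) for every 1 ≤ r < s; that is, the sequence (I_1,…,I_s) is strongly stable. -/
open scoped Classical

noncomputable section

namespace LLLFormal

/-- A flaw absent from the current state cannot be addressed after a sequence of steps none of
which can cause it. -/
theorem not_validFrom_of_not_mem {Ω F : Type*} [Fintype Ω] {S : Setup Ω F} {sim : F → F → Prop}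
    (hcaus : Causality S sim) {g : F} {Q : List F} {σ : Ω} {l : List (F × Ω)} {M : List F}
    (hM : ∀ x ∈ M, ¬ sim x g) (hg : ¬ S.mem g σ) (hl : l.map Prod.fst = M ++ g :: Q) :
    ¬ ValidFrom S.step σ l := by
  induction l generalizing σ M with
  | nil => simp at hl
  | cons p l ih =>
    obtain ⟨f, σ'⟩ := p
    rintro ⟨hstep, hvalid⟩
    cases M with
    | nil =>
      obtain ⟨rfl, -⟩ : f = g ∧ _ := by simpa using hl
      exact hg hstep.1
    | cons x M =>
      obtain ⟨rfl, hl'⟩ : f = x ∧ l.map Prod.fst = M ++ g :: Q := by simpa using hl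
      refine ih (fun y hy => hM y (by simp [hy])) (fun h => ?_) hl' hvalid
      rcases hcaus f σ σ' hstep g h with h | h
      · exact hg h.1
      · exact hM f (by simp) h

/-- Between two occurrences of a flaw that does not cause itself, some flaw that can cause it must
be addressed. -/
theorem not_validFrom_of_repeat {Ω F : Type*} [Fintype Ω] {S : Setup Ω F} {sim : F → F → Prop}
    (hcaus : Causality S sim) {g : F} {P M Q : List F} {σ : Ω} {l : List (F × Ω)}
    (hg : ¬ sim g g) (hM : ∀ x ∈ M, ¬ sim x g)
    (hl : l.map Prod.fst = P ++ g :: (M ++ g :: Q)) : ¬ ValidFrom S.step σ l := by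
  induction l generalizing σ P with
  | nil => simp at hl
  | cons p l ih =>
    obtain ⟨f, σ'⟩ := p
    rintro ⟨hstep, hvalid⟩
    cases P with
    | nil =>
      obtain ⟨rfl, hl'⟩ : f = g ∧ l.map Prod.fst = M ++ g :: Q := by simpa using hl
      refine not_validFrom_of_not_mem hcaus hM (fun h => ?_) hl' hvalid
      rcases hcaus f σ σ' hstep f h with h | h
      · exact h.2 rfl
      · exact hg h
    | cons x P =>
      obtain ⟨-, hl'⟩ : f = x ∧ l.map Prod.fst = P ++ g :: (M ++ g :: Q) := by simpa using hl
      exact ih hl' hvalid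

/-- if `(F,∼)` is a potential causality graph and `W ∈ Stab_π` has block
flaw sets `(I_1,…,I_s)`, then `I_{r+1} ⊆ Γ(I_r)` for every `r < s`, i.e. the sequence is
strongly stable. -/
theorem stmt_14 {Ω F : Type*} [Fintype Ω] [LinearOrder F]
    (S : Setup Ω F) (sim : F → F → Prop) (hsym : Symmetric sim) (hcaus : Causality S sim)
    (W : List F) (B : List (List F)) (hB : PiStablePartition sim B W)
    (hwalk : ∃ τ : Walk Ω F, Walk.Valid S.step τ ∧
      (Walk.word τ = W ∨ Walk.word τ = W.reverse)) :
    B.Chain' fun b₁ b₂ => ∀ g ∈ b₂, ∃ f ∈ b₁, sim f g := by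
  obtain ⟨⟨hW, hblocks, hchain⟩, -⟩ := hB
  obtain ⟨τ, hτ, hword⟩ := hwalk
  refine List.isChain_iff_forall_rel_of_append_cons_cons.2 ?_
  intro b₁ b₂ L R hB g hg₂
  obtain ⟨f, hf, hfg⟩ := List.isChain_iff_forall_rel_of_append_cons_cons.1 hchain hB g hg₂
  rcases hfg with rfl | hfg
  swap
  · exact ⟨f, hf, hfg⟩
  by_contra! hnot
  obtain ⟨P, M₁, rfl⟩ := List.append_of_mem hf
  obtain ⟨M₂, Q, rfl⟩ := List.append_of_mem hg₂
  have hM : ∀ x ∈ M₁ ++ M₂, ¬ sim x f := by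
    intro x hx
    rcases List.mem_append.1 hx with hx | hx
    · exact hnot x (by simp [hx])
    · exact (List.pairwise_append.1 (hblocks (M₂ ++ f :: Q) (by simp [hB])).2.2).2.2 x hx f
        (by simp)
  have hff : ¬ sim f f := hnot f hf
  rcases hword with h | h
  · refine not_validFrom_of_repeat (P := L.flatten ++ P) (Q := Q ++ R.flatten) hcaus hff hM ?_ hτ
    simpa [hB, Walk.word] using h.trans hW
  · refine not_validFrom_of_repeat (M := (M₁ ++ M₂).reverse) (P := (Q ++ R.flatten).reverse)
      (Q := (L.flatten ++ P).reverse) hcaus hff (fun x hx => hM x (List.mem_reverse.1 hx)) ?_ hτ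
    refine h.trans ?_
    rw [hW, hB]
    simp

end LLLFormal
end
end

section
/- Suppose (F,∼) is a potential causality graph and (λ,μ,θ) satisfy the cluster-expansion condition. Then for every independent set R ⊆ F and every integer t ≥ 0, ∑_{W ∈ Stab_π(R,t)} λ_W ≤ μ(R)·θ^t, where μ(R) = ∏_{f∈R} μ_f and λ_W = ∏_i λ_{w_i} for W = w_1⋯w_t. -/
open scoped Classical

noncomputable section

namespace LLLFormal

/-- Between two occurrences of a flaw in the word there is a neighbour of that flaw
(possibly the first of these two occurrences itself). -/
def Reintroduced {F : Type*} (sim : F → F → Prop) (W : List F) : Prop :=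
  ∀ A M C f, W = A ++ (f :: M ++ f :: C) → ∃ g ∈ f :: M, sim g f

theorem Reintroduced.of_reverse {F : Type*} {sim : F → F → Prop} {W : List F}
    (h : Reintroduced sim W.reverse) : Reintroduced sim W := by
  intro A M C f hW
  obtain ⟨g, hg, hs⟩ := h C.reverse M.reverse A.reverse f (by simp [hW])
  exact ⟨g, by simpa using hg, hs⟩

theorem Reintroduced.of_append_left {F : Type*} {sim : F → F → Prop} {V W : List F}
    (h : Reintroduced sim (V ++ W)) : Reintroduced sim W := by
  intro A M C f hW
  exact h (V ++ A) M C f (by simp [hW])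

theorem exists_sim_of_not_mem {Ω F : Type*} [Fintype Ω] {S : Setup Ω F} {sim : F → F → Prop}
    (hcaus : Causality S sim) {f : F} (l : List (F × Ω)) :
    ∀ (σ : Ω) (M C : List F), ValidFrom S.step σ l → l.map Prod.fst = M ++ f :: C →
      ¬ S.mem f σ → ∃ g ∈ M, sim g f := by
  induction l with
  | nil => intro σ M C _ h; simp at h
  | cons p l ih =>
    obtain ⟨m, σ'⟩ := p
    intro σ M C hv hw hf
    obtain ⟨hstep, hv⟩ := hv
    cases M with
    | nil =>
      simp only [List.map_cons, List.nil_append, List.cons.injEq] at hw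
      exact absurd (hw.1 ▸ hstep.1) hf
    | cons m' M =>
      simp only [List.map_cons, List.cons_append, List.cons.injEq] at hw
      obtain ⟨rfl, hw⟩ := hw
      by_cases hf' : S.mem f σ'
      · rcases hcaus m σ σ' hstep f hf' with h | h
        · exact absurd h.1 hf
        · exact ⟨m, by simp, h⟩
      · obtain ⟨g, hg, hs⟩ := ih σ' M C hv hw hf'
        exact ⟨g, by simp [hg], hs⟩

theorem reintroduced_of_validFrom {Ω F : Type*} [Fintype Ω] {S : Setup Ω F}
    {sim : F → F → Prop} (hcaus : Causality S sim) (l : List (F × Ω)) :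
    ∀ σ : Ω, ValidFrom S.step σ l → Reintroduced sim (l.map Prod.fst) := by
  induction l with
  | nil => intro σ _ A M C f h; simp at h
  | cons p l ih =>
    obtain ⟨m, σ'⟩ := p
    intro σ hv A M C f hw
    obtain ⟨hstep, hv⟩ := hv
    cases A with
    | nil =>
      simp only [List.map_cons, List.nil_append, List.cons_append, List.cons.injEq] at hw
      obtain ⟨rfl, hw⟩ := hw
      by_cases hm : S.mem m σ'
      · rcases hcaus m σ σ' hstep m hm with h | h
        · exact absurd rfl h.2
        · exact ⟨m, by simp, h⟩
      · obtain ⟨g, hg, hs⟩ := exists_sim_of_not_mem hcaus l σ' M C hv hw hm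
        exact ⟨g, by simp [hg], hs⟩
    | cons a A =>
      simp only [List.map_cons, List.cons_append, List.cons.injEq] at hw
      exact ih σ' hv A M C f (by simpa using hw.2)

/-- The independent sets contained in `Γ(R)`. -/
def indepNbrs {F : Type*} [Fintype F] (sim : F → F → Prop) (R : Finset F) : Finset (Finset F) :=
  Finset.univ.filter fun I : Finset F => (∀ g ∈ I, ∃ f ∈ R, sim f g) ∧ IndepF sim I

theorem indepNbrs_singleton {F : Type*} [Fintype F] (sim : F → F → Prop) (f : F)
    [DecidablePred fun I : Finset F => (∀ g ∈ I, sim f g) ∧ IndepF sim I] :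
    indepNbrs sim {f} =
      Finset.univ.filter fun I : Finset F => (∀ g ∈ I, sim f g) ∧ IndepF sim I := by
  ext I
  simp [indepNbrs]

/-- Words splitting into at most `n` nonempty, increasing, independent blocks, the first of which
is `R`, such that every block is contained in `Γ` of the previous one. -/
def stableWords {F : Type*} [Fintype F] [LinearOrder F] (sim : F → F → Prop) :
    ℕ → Finset F → Finset (List F)
  | 0, R => if R = ∅ then {[]} else ∅
  | n + 1, R => (indepNbrs sim R).biUnion fun I =>
      (stableWords sim n I).image fun W => R.sort ++ W

theorem nil_mem_stableWords {F : Type*} [Fintype F] [LinearOrder F] (sim : F → F → Prop)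
    (n : ℕ) : [] ∈ stableWords sim n ∅ := by
  induction n with
  | zero => simp [stableWords]
  | succ n ih =>
    simp only [stableWords, Finset.mem_biUnion, Finset.mem_image]
    exact ⟨∅, by simp [indepNbrs, IndepF], [], ih, by simp⟩

theorem flatten_mem_stableWords {F : Type*} [Fintype F] [LinearOrder F] {sim : F → F → Prop}
    (B : List (List F)) (hind : ∀ b ∈ B, IndepF sim b.toFinset)
    (hsort : ∀ b ∈ B, b.IsChain (· < ·))
    (hchain : B.IsChain fun b₁ b₂ => ∀ g ∈ b₂, ∃ f ∈ b₁, sim f g) :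
    ∀ n, B.length ≤ n → B.flatten ∈ stableWords sim n B.headI.toFinset := by
  induction B with
  | nil => intro n _; exact nil_mem_stableWords sim n
  | cons b B ih =>
    intro n hn
    obtain ⟨n, rfl⟩ : ∃ k, n = k + 1 := ⟨n - 1, by simp at hn; omega⟩
    simp only [stableWords, Finset.mem_biUnion, Finset.mem_image]
    refine ⟨B.headI.toFinset, ?_, B.flatten, ?_, ?_⟩
    · cases B with
      | nil => simp [indepNbrs, IndepF, List.headI_nil, default]
      | cons b' B =>
        have h := hind b' (by simp)
        rw [List.isChain_cons_cons] at hchain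
        simpa [indepNbrs, h] using hchain.1
    · exact ih (fun b' hb => hind b' (by simp [hb])) (fun b' hb => hsort b' (by simp [hb]))
        hchain.tail n (by simpa using hn)
    · have h : b.Pairwise (· < ·) := List.isChain_iff_pairwise.1 (hsort b (by simp))
      have hs : b.toFinset.sort = b :=
        (List.toFinset_sort (· ≤ ·) (h.imp fun h => h.ne)).2 (h.imp fun h => h.le)
      simp [hs]

theorem IndepF.mono {F : Type*} {sim : F → F → Prop} {I J : Finset F} (hJ : IndepF sim J)
    (h : I ⊆ J) : IndepF sim I :=
  fun f hf g hg => hJ f (h hf) g (h hg)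

theorem sum_indepNbrs_le_prod {F : Type*} [Fintype F] [LinearOrder F] (sim : F → F → Prop)
    {μ : F → ℝ} (hμ : ∀ f, 0 < μ f) (R : Finset F) :
    ∑ I ∈ indepNbrs sim R, ∏ g ∈ I, μ g ≤
      ∏ f ∈ R, ∑ I ∈ indepNbrs sim {f}, ∏ g ∈ I, μ g := by
  have hpos : ∀ I : Finset F, 0 ≤ ∏ g ∈ I, μ g := fun I => Finset.prod_nonneg fun g _ => (hμ g).le
  induction R using Finset.induction_on with
  | empty =>
    have : indepNbrs sim ∅ = {∅} := by
      ext I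
      simp only [indepNbrs, Finset.mem_filter, Finset.mem_univ, true_and, Finset.mem_singleton]
      constructor
      · intro h
        exact Finset.eq_empty_of_forall_notMem fun g hg => by simpa using h.1 g hg
      · rintro rfl
        simp [IndepF]
    simp [this]
  | insert f R hf ih =>
    rw [Finset.prod_insert hf]
    refine le_trans ?_ (mul_le_mul_of_nonneg_left ih (Finset.sum_nonneg fun I _ => hpos I))
    rw [Finset.sum_mul_sum, ← Finset.sum_product']
    have hinj : Set.InjOn (fun I : Finset F => (I.filter (sim f), I.filter fun g => ¬ sim f g))
        (indepNbrs sim (insert f R) : Set (Finset F)) := by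
      intro I _ J _ h
      simp only [Prod.mk.injEq] at h
      rw [← Finset.filter_union_filter_not_eq (sim f) I, h.1, h.2,
        Finset.filter_union_filter_not_eq]
    have hsum : ∑ I ∈ indepNbrs sim (insert f R), ∏ g ∈ I, μ g =
        ∑ p ∈ (indepNbrs sim (insert f R)).image
          (fun I : Finset F => (I.filter (sim f), I.filter fun g => ¬ sim f g)),
          (∏ g ∈ p.1, μ g) * ∏ g ∈ p.2, μ g := by
      rw [Finset.sum_image hinj]
      exact Finset.sum_congr rfl fun I _ => (Finset.prod_filter_mul_prod_filter_not I _ _).symm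
    rw [hsum]
    refine Finset.sum_le_sum_of_subset_of_nonneg ?_
      fun p _ _ => mul_nonneg (hpos _) (hpos _)
    intro p hp
    obtain ⟨I, hI, rfl⟩ := Finset.mem_image.1 hp
    simp only [indepNbrs, Finset.mem_filter, Finset.mem_univ, true_and] at hI
    simp only [indepNbrs, Finset.mem_product, Finset.mem_filter, Finset.mem_univ, true_and]
    refine ⟨⟨fun g hg => ⟨f, by simp, hg.2⟩, hI.2.mono (Finset.filter_subset _ _)⟩,
      fun g hg => ?_, hI.2.mono (Finset.filter_subset _ _)⟩
    obtain ⟨f', hf', hs⟩ := hI.1 g hg.1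
    rcases Finset.mem_insert.1 hf' with rfl | hf'
    · exact absurd hs hg.2
    · exact ⟨f', hf', hs⟩

theorem wordWt_append {F : Type*} (lam : F → ℝ) (V W : List F) :
    wordWt lam (V ++ W) = wordWt lam V * wordWt lam W := by
  simp [wordWt]

theorem wordWt_nonneg {F : Type*} {lam : F → ℝ} (hlam : ∀ f, 0 ≤ lam f) (W : List F) :
    0 ≤ wordWt lam W :=
  List.prod_nonneg fun x hx => by
    obtain ⟨f, _, rfl⟩ := List.mem_map.1 hx
    exact hlam f

theorem wordWt_sort {F : Type*} [LinearOrder F] (lam : F → ℝ) (R : Finset F) :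
    wordWt lam R.sort = ∏ f ∈ R, lam f := by
  rw [wordWt, ← List.prod_toFinset lam (R.sort_nodup _), Finset.sort_toFinset]

theorem wordWt_eq_mul_pow {F : Type*} (lam : F → ℝ) {θ : ℝ} (hθ : θ ≠ 0) (W : List F) :
    wordWt lam W = wordWt (fun f => lam f / θ) W * θ ^ W.length := by
  induction W with
  | nil => simp [wordWt]
  | cons f W ih =>
    simp only [wordWt, List.map_cons, List.prod_cons, List.length_cons] at ih ⊢
    rw [ih, pow_succ]
    field_simp

theorem sum_biUnion_le_sum_sum {ι α : Type*} [DecidableEq α] {w : α → ℝ} (hw : ∀ a, 0 ≤ w a)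
    (s : Finset ι) (t : ι → Finset α) :
    ∑ a ∈ s.biUnion t, w a ≤ ∑ i ∈ s, ∑ a ∈ t i, w a := by
  induction s using Finset.induction_on with
  | empty => simp
  | insert i s hi ih =>
    rw [Finset.biUnion_insert, Finset.sum_insert hi]
    have h := Finset.sum_union_inter (s₁ := t i) (s₂ := s.biUnion t) (f := w)
    have h' : 0 ≤ ∑ a ∈ t i ∩ s.biUnion t, w a := Finset.sum_nonneg fun a _ => hw a
    linarith

theorem sum_stableWords_le {F : Type*} [Fintype F] [LinearOrder F] {sim : F → F → Prop}
    {lam μ : F → ℝ} (hlam : ∀ f, 0 ≤ lam f) (hμ : ∀ f, 0 < μ f)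
    (h : ∀ f, lam f * ∑ I ∈ indepNbrs sim {f}, ∏ g ∈ I, μ g ≤ μ f) (n : ℕ) :
    ∀ R : Finset F, ∑ W ∈ stableWords sim n R, wordWt lam W ≤ ∏ f ∈ R, μ f := by
  induction n with
  | zero =>
    intro R
    by_cases hR : R = ∅
    · simp [stableWords, hR, wordWt]
    · simpa [stableWords, hR] using Finset.prod_nonneg fun f _ => (hμ f).le
  | succ n ih =>
    intro R
    have hR : 0 ≤ ∏ f ∈ R, lam f := Finset.prod_nonneg fun f _ => hlam f
    calc ∑ W ∈ stableWords sim (n + 1) R, wordWt lam W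
        ≤ ∑ I ∈ indepNbrs sim R, ∑ W ∈ (stableWords sim n I).image fun W => R.sort ++ W,
            wordWt lam W := by
          rw [stableWords]
          exact sum_biUnion_le_sum_sum (wordWt_nonneg hlam) _ _
      _ = ∑ I ∈ indepNbrs sim R, (∏ f ∈ R, lam f) * ∑ W ∈ stableWords sim n I, wordWt lam W := by
          refine Finset.sum_congr rfl fun I _ => ?_
          rw [Finset.sum_image fun V _ W _ h => List.append_cancel_left h, Finset.mul_sum]
          exact Finset.sum_congr rfl fun W _ => by rw [wordWt_append, wordWt_sort]
      _ ≤ ∑ I ∈ indepNbrs sim R, (∏ f ∈ R, lam f) * ∏ g ∈ I, μ g :=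
          Finset.sum_le_sum fun I _ => mul_le_mul_of_nonneg_left (ih I) hR
      _ ≤ (∏ f ∈ R, lam f) * ∏ f ∈ R, ∑ I ∈ indepNbrs sim {f}, ∏ g ∈ I, μ g := by
          rw [← Finset.mul_sum]
          exact mul_le_mul_of_nonneg_left (sum_indepNbrs_le_prod sim hμ R) hR
      _ ≤ ∏ f ∈ R, μ f := by
          rw [← Finset.prod_mul_distrib]
          refine Finset.prod_le_prod (fun f _ => mul_nonneg (hlam f) ?_) fun f _ => h f
          exact Finset.sum_nonneg fun I _ => Finset.prod_nonneg fun g _ => (hμ g).le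

theorem isChain_sim_of_reintroduced {F : Type*} {sim : F → F → Prop}
    (B : List (List F)) (hpw : ∀ b ∈ B, b.Pairwise fun f g => ¬ sim f g)
    (hchain : B.IsChain fun b₁ b₂ => ∀ g ∈ b₂, ∃ f ∈ b₁, f = g ∨ sim f g)
    (hW : Reintroduced sim B.flatten) :
    B.IsChain fun b₁ b₂ => ∀ g ∈ b₂, ∃ f ∈ b₁, sim f g := by
  induction B with
  | nil => simp
  | cons b₁ B ih =>
    cases B with
    | nil => simp
    | cons b₂ B =>
      rw [List.isChain_cons_cons] at hchain ⊢
      refine ⟨fun g hg => ?_, ih (fun b hb => hpw b (by simp [hb])) hchain.2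
        (Reintroduced.of_append_left (V := b₁) (by simpa using hW))⟩
      obtain ⟨f, hf, rfl | hs⟩ := hchain.1 g hg
      · obtain ⟨A, M, rfl⟩ := List.append_of_mem hf
        obtain ⟨N, C, rfl⟩ := List.append_of_mem hg
        obtain ⟨h, hh, hs⟩ := hW A (M ++ N) (C ++ B.flatten) f (by simp)
        have hN : h ∉ N := fun hN =>
          (List.pairwise_append.1 (hpw (N ++ f :: C) (by simp))).2.2 h hN f (by simp) hs
        refine ⟨h, ?_, hs⟩
        simp only [List.mem_cons, List.mem_append] at hh ⊢
        tauto
      · exact ⟨f, hf, hs⟩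

theorem length_le_length_flatten {α : Type*} (B : List (List α)) (h : ∀ b ∈ B, b ≠ []) :
    B.length ≤ B.flatten.length := by
  induction B with
  | nil => simp
  | cons b B ih =>
    have := ih fun b' hb => h b' (by simp [hb])
    have := List.length_pos_iff.2 (h b (by simp))
    simp only [List.length_cons, List.flatten_cons, List.length_append]
    omega

theorem IndepF.of_pairwise {F : Type*} [DecidableEq F] {sim : F → F → Prop}
    (hsym : ∀ f g, sim f g → sim g f) {b : List F} (h : b.Pairwise fun f g => ¬ sim f g) :
    IndepF sim b.toFinset := by
  intro f hf g hg hne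
  have : Std.Symm fun f g => ¬ sim f g := ⟨fun f g hfg hgf => hfg (hsym _ _ hgf)⟩
  exact h.forall (by simpa using hf) (by simpa using hg) hne

/-- Theorem "StabCounting", cluster-expansion case:
`∑_{W ∈ Stab_π(R,t)} λ_W ≤ μ(R) θ^t` for every independent set `R` and `t ≥ 0`;
stated as: every finite set of words belonging to `Stab_π(R,t)` has total weight at most
`μ(R) θ^t`. -/
theorem stmt_15 {Ω F : Type*} [Fintype Ω] [Fintype F] [LinearOrder F]
    (S : Setup Ω F) (sim : F → F → Prop) (hsym : Symmetric sim) (hcaus : Causality S sim)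
    (lam μ : F → ℝ) (θ : ℝ)
    (hlam : ∀ f, 0 < lam f) (hμ : ∀ f, 0 < μ f) (hθ0 : 0 < θ) (hθ1 : θ < 1)
    (hCE : ClusterCond sim lam μ θ)
    (R : Finset F) (hR : IndepF sim R) (t : ℕ)
    (X : Finset (List F))
    (hX : ∀ W ∈ X,
      (∃ B : List (List F), PiStablePartition sim B W ∧ B.headI.toFinset = R) ∧
      (∃ τ : Walk Ω F, Walk.Valid S.step τ ∧
        (Walk.word τ = W ∨ Walk.word τ = W.reverse)) ∧
      t ≤ W.length) :
    (∑ W ∈ X, wordWt lam W) ≤ (∏ f ∈ R, μ f) * θ ^ t := by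
  have hr : ∀ W ∈ X, Reintroduced sim W := by
    intro W hW
    obtain ⟨-, ⟨τ, hτ, hw⟩, -⟩ := hX W hW
    have h : Reintroduced sim (Walk.word τ) := reintroduced_of_validFrom hcaus τ.steps τ.start hτ
    rcases hw with rfl | hw
    · exact h
    · exact Reintroduced.of_reverse (hw ▸ h)
  have hsub : X ⊆ stableWords sim (X.sup List.length) R := by
    intro W hW
    obtain ⟨⟨B, ⟨⟨rfl, hb, hc⟩, hlt⟩, rfl⟩, -, -⟩ := hX W hW
    refine flatten_mem_stableWords B
      (fun b h => IndepF.of_pairwise (fun f g hs => hsym hs) (hb b h).2.2) hlt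
      (isChain_sim_of_reintroduced B (fun b h => (hb b h).2.2) hc (hr _ hW)) _ ?_
    exact (length_le_length_flatten B fun b h => (hb b h).1).trans
      (Finset.le_sup (f := List.length) hW)
  have hlam' : ∀ f, 0 ≤ lam f / θ := fun f => (div_pos (hlam f) hθ0).le
  have hCE' : ∀ f, lam f / θ * ∑ I ∈ indepNbrs sim {f}, ∏ g ∈ I, μ g ≤ μ f := by
    intro f
    have h := hCE f
    rw [← indepNbrs_singleton, div_mul_eq_mul_div, div_le_iff₀ (hμ f)] at h
    rw [div_mul_eq_mul_div, div_le_iff₀ hθ0, mul_comm (μ f)]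
    exact h
  calc ∑ W ∈ X, wordWt lam W
      ≤ ∑ W ∈ X, wordWt (fun f => lam f / θ) W * θ ^ t := by
        refine Finset.sum_le_sum fun W hW => ?_
        rw [wordWt_eq_mul_pow lam hθ0.ne' W]
        exact mul_le_mul_of_nonneg_left (pow_le_pow_of_le_one hθ0.le hθ1.le (hX W hW).2.2)
          (wordWt_nonneg hlam' W)
    _ = (∑ W ∈ X, wordWt (fun f => lam f / θ) W) * θ ^ t := (Finset.sum_mul _ _ _).symm
    _ ≤ (∏ f ∈ R, μ f) * θ ^ t := by
        refine mul_le_mul_of_nonneg_right ?_ (pow_nonneg hθ0.le t)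
        exact (Finset.sum_le_sum_of_subset_of_nonneg hsub fun W _ _ =>
          wordWt_nonneg hlam' W).trans (sum_stableWords_le hlam' hμ hCE' _ R)

end LLLFormal
end
end

section
/- Let G be a finite simple graph on an even number of vertices satisfying condition (*). Let σ be a perfect matching of G and e = {u,v} ∈ E(G) any edge. Then ψ̂(e,σ) is a perfect matching of G containing e; moreover, if e ∈ σ then ψ̂(e,σ) = σ. -/
open scoped Classical

noncomputable section

namespace PMFormal

variable {V : Type*}

/-- `σ` is a perfect matching of `G`: a set of edges of `G` such that every vertex
belongs to exactly one edge of `σ`. -/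
def IsPM (G : SimpleGraph V) (σ : Set (Sym2 V)) : Prop :=
  σ ⊆ G.edgeSet ∧ ∀ v : V, ∃! e, e ∈ σ ∧ v ∈ e

/-- The vertex matched to `u` in `σ` (an arbitrary junk value if none exists). -/
def partner (σ : Set (Sym2 V)) (u : V) : V :=
  if h : ∃ w, s(u, w) ∈ σ then h.choose else u

/-- The resampling map `ψ̂({u,v}, σ)`: with `u' = partner σ u` and `v' = partner σ v`,
`ψ̂({u,v},σ) = (σ − {{u,u'},{v,v'}}) ∪ {{u,v},{u',v'}}`. -/
def psiHat (σ : Set (Sym2 V)) (u v : V) : Set (Sym2 V) :=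
  (σ \ {s(u, partner σ u), s(v, partner σ v)}) ∪ {s(u, v), s(partner σ u, partner σ v)}

/-- Condition (*): whenever `u', u, v, v'` are four distinct vertices forming a path
`u' - u - v - v'` in `G`, also `{u',v'}` is an edge of `G`. -/
def CondStar (G : SimpleGraph V) : Prop :=
  ∀ u' u v v' : V, u' ≠ u → u' ≠ v → u' ≠ v' → u ≠ v → u ≠ v' → v ≠ v' →
    G.Adj u' u → G.Adj u v → G.Adj v v' → G.Adj u' v'

end PMFormal

namespace PMFormal

/-- A set of edges is a perfect matching iff every vertex has exactly one neighbour in it. -/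
theorem isPM_iff {V : Type*} {G : SimpleGraph V} {σ : Set (Sym2 V)} :
    IsPM G σ ↔ (∀ a b, s(a, b) ∈ σ → G.Adj a b) ∧ ∀ a, ∃! b, s(a, b) ∈ σ := by
  refine and_congr ⟨fun h a b hab => h hab, fun h e => ?_⟩ (forall_congr' fun a => ⟨?_, ?_⟩)
  · induction e with | _ a b => exact h a b
  · rintro ⟨e, ⟨he, b, rfl⟩, huniq⟩
    exact ⟨b, he, fun c hc => Sym2.congr_right.mp (huniq _ ⟨hc, Sym2.mem_mk_left a c⟩)⟩
  · rintro ⟨b, hb, huniq⟩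
    refine ⟨s(a, b), ⟨hb, Sym2.mem_mk_left a b⟩, ?_⟩
    rintro e ⟨he, c, rfl⟩
    rw [huniq c he]

theorem IsPM.mk_mem_iff {V : Type*} {G : SimpleGraph V} {σ : Set (Sym2 V)}
    (hσ : IsPM G σ) (a b : V) :
    s(a, b) ∈ σ ↔ b = partner σ a := by
  have hex := (isPM_iff.mp hσ).2 a
  have hp : s(a, partner σ a) ∈ σ := by
    rw [partner, dif_pos hex.exists]
    exact hex.exists.choose_spec
  exact ⟨fun h => hex.unique h hp, fun h => h ▸ hp⟩

theorem IsPM.partner_partner {V : Type*} {G : SimpleGraph V} {σ : Set (Sym2 V)}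
    (hσ : IsPM G σ) (a : V) :
    partner σ (partner σ a) = a := by
  rw [eq_comm, ← hσ.mk_mem_iff, Sym2.eq_swap, hσ.mk_mem_iff]

theorem IsPM.adj_partner {V : Type*} {G : SimpleGraph V} {σ : Set (Sym2 V)}
    (hσ : IsPM G σ) (a : V) :
    G.Adj a (partner σ a) :=
  (isPM_iff.mp hσ).1 a _ ((hσ.mk_mem_iff a _).mpr rfl)

theorem IsPM.psiHat_eq_self {V : Type*} {G : SimpleGraph V} {σ : Set (Sym2 V)}
    (hσ : IsPM G σ) {u v : V}
    (h : s(u, v) ∈ σ) : psiHat σ u v = σ := by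
  obtain rfl := (hσ.mk_mem_iff u v).mp h
  rw [psiHat, hσ.partner_partner, Sym2.eq_swap (a := partner σ u), Set.pair_eq_singleton,
    Set.sdiff_union_self, Set.union_eq_left, Set.singleton_subset_iff]
  exact h

theorem IsPM.isPM_psiHat {V : Type*} {G : SimpleGraph V} (hstar : CondStar G) {σ : Set (Sym2 V)}
    (hσ : IsPM G σ)
    {u v : V} (huv : G.Adj u v) : IsPM G (psiHat σ u v) := by
  by_cases h : s(u, v) ∈ σ
  · rwa [hσ.psiHat_eq_self h]
  have hinv := hσ.partner_partner
  have hadj := hσ.adj_partner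
  have hne a : a ≠ partner σ a := (hadj a).ne
  have huv_ne := huv.ne
  rw [hσ.mk_mem_iff] at h
  have huv' : G.Adj (partner σ u) (partner σ v) := by
    apply hstar _ u v _ _ _ _ _ _ _ (hadj u).symm huv (hadj v) <;> grind
  have hmem a b : s(a, b) ∈ psiHat σ u v ↔
      (b = partner σ a ∧ ¬(a = u ∨ a = v ∨ a = partner σ u ∨ a = partner σ v)) ∨
        (a = u ∧ b = v ∨ a = v ∧ b = u) ∨
        (a = partner σ u ∧ b = partner σ v ∨ a = partner σ v ∧ b = partner σ u) := by
    simp only [psiHat, Set.mem_union, Set.mem_sdiff, Set.mem_insert_iff,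
      Set.mem_singleton_iff, hσ.mk_mem_iff, Sym2.eq_iff]
    grind
  refine isPM_iff.mpr ⟨fun a b hab => ?_, fun a => ?_⟩
  · rw [hmem] at hab
    have := huv.symm
    have := huv'.symm
    grind
  · simp only [hmem]
    by_cases hau : a = u
    · exact ⟨v, by grind, by grind⟩
    by_cases hav : a = v
    · exact ⟨u, by grind, by grind⟩
    by_cases hau' : a = partner σ u
    · exact ⟨partner σ v, by grind, by grind⟩
    by_cases hav' : a = partner σ v
    · exact ⟨partner σ u, by grind, by grind⟩
    exact ⟨partner σ a, by grind, by grind⟩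

/-- for a finite simple graph `G` on an even number of vertices satisfying
condition (*), a perfect matching `σ` of `G` and an edge `{u,v}` of `G`, the set
`ψ̂({u,v},σ)` is a perfect matching of `G` containing `{u,v}`; moreover if `{u,v} ∈ σ`
then `ψ̂({u,v},σ) = σ`. -/
theorem stmt_17 {V : Type*} [Fintype V]
    (G : SimpleGraph V) (heven : Even (Fintype.card V)) (hstar : CondStar G)
    (σ : Set (Sym2 V)) (hσ : IsPM G σ) (u v : V) (huv : G.Adj u v) :
    IsPM G (psiHat σ u v) ∧ s(u, v) ∈ psiHat σ u v ∧
      (s(u, v) ∈ σ → psiHat σ u v = σ) := by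
  exact ⟨hσ.isPM_psiHat hstar huv, Or.inr (Or.inl rfl), hσ.psiHat_eq_self⟩

end PMFormal
end
end

section
/- There exists an integer n_0 such that for every n ≥ n_0 the following holds: if the edges of the complete graph on 2n vertices are colored so that each color is used on at most ⌊0.21·n⌋ edges, then there exists a rainbow perfect matching, i.e., a perfect matching whose edges receive pairwise distinct colors. -/
open scoped Classical

noncomputable section

namespace PMFormal

section LocalLemma

variable {ι α : Type*}

/-- The independence polynomial, evaluated at `μ`, of the graph that `r` induces on `S`. -/
def indepPoly (r : ι → ι → Prop) (μ : ℝ) (S : Finset ι) : ℝ :=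
  ∑ I ∈ S.powerset, if (I : Set ι).Pairwise (fun i j => ¬ r i j) then μ ^ I.card else 0

variable {r : ι → ι → Prop} {μ : ℝ}

theorem indepPoly_empty : indepPoly r μ ∅ = 1 := by
  simp [indepPoly]

theorem indepPoly_mono (hμ : 0 ≤ μ) {S T : Finset ι} (h : S ⊆ T) :
    indepPoly r μ S ≤ indepPoly r μ T := by
  refine Finset.sum_le_sum_of_subset_of_nonneg (Finset.powerset_mono.2 h) fun I _ _ => ?_
  split_ifs <;> positivity

theorem indepPoly_pos (hμ : 0 ≤ μ) (S : Finset ι) : 0 < indepPoly r μ S := by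
  have h := indepPoly_mono (r := r) hμ (Finset.empty_subset S)
  rw [indepPoly_empty] at h
  linarith

theorem indepPoly_insert [DecidableEq ι] (hr : ∀ i j, r i j → r j i) {a : ι} {S : Finset ι} (ha : a ∉ S) :
    indepPoly r μ (insert a S) =
      indepPoly r μ S + μ * indepPoly r μ (S.filter fun b => ¬ r a b) := by
  have hpow : (S.filter fun b => ¬ r a b).powerset =
      S.powerset.filter fun I => ∀ b ∈ I, ¬ r a b := by
    ext I
    simp only [Finset.mem_powerset, Finset.mem_filter, Finset.subset_iff]
    grind
  unfold indepPoly
  rw [Finset.sum_powerset_insert ha, hpow, Finset.sum_filter, Finset.mul_sum]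
  congr 1
  refine Finset.sum_congr rfl fun I hI => ?_
  have haI : a ∉ I := fun h => ha (Finset.mem_powerset.1 hI h)
  have hiff : ((insert a I : Finset ι) : Set ι).Pairwise (fun i j => ¬ r i j) ↔
      (I : Set ι).Pairwise (fun i j => ¬ r i j) ∧ ∀ b ∈ I, ¬ r a b := by
    rw [Finset.coe_insert, Set.pairwise_insert_of_notMem (by simpa using haI)]
    refine and_congr_right fun _ => forall₂_congr fun b _ => ?_
    exact ⟨fun h => h.1, fun h => ⟨h, fun h' => h (hr _ _ h')⟩⟩
  rw [Finset.card_insert_of_notMem haI]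
  by_cases h1 : (I : Set ι).Pairwise (fun i j => ¬ r i j) <;>
    by_cases h2 : ∀ b ∈ I, ¬ r a b
  · rw [if_pos (hiff.2 ⟨h1, h2⟩), if_pos h2, if_pos h1, pow_succ']
  · rw [if_neg (fun h => h2 (hiff.1 h).2), if_neg h2, mul_zero]
  · rw [if_neg (fun h => h1 (hiff.1 h).1), if_pos h2, if_neg h1, mul_zero]
  · rw [if_neg (fun h => h2 (hiff.1 h).2), if_neg h2, mul_zero]

theorem indepPoly_union_le [DecidableEq ι] (hr : ∀ i j, r i j → r j i) (hμ : 0 ≤ μ) (S T : Finset ι) :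
    indepPoly r μ (S ∪ T) ≤ indepPoly r μ S * indepPoly r μ T := by
  induction S using Finset.strongInduction generalizing T with
  | H S ih =>
    obtain rfl | ⟨a, ha⟩ := S.eq_empty_or_nonempty
    · simp [indepPoly_empty]
    obtain ⟨S, haS, rfl⟩ : ∃ S', a ∉ S' ∧ insert a S' = S :=
      ⟨S.erase a, by simp, Finset.insert_erase ha⟩
    have hlt : S ⊂ insert a S := Finset.ssubset_insert haS
    have hT := indepPoly_pos (r := r) hμ T
    have hS := ih S hlt T
    by_cases haT : a ∈ T
    · have : insert a S ∪ T = S ∪ T := by grind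
      rw [this]
      exact hS.trans (mul_le_mul_of_nonneg_right
        (indepPoly_mono hμ (Finset.subset_insert _ _)) hT.le)
    · have haST : a ∉ S ∪ T := by simp [haS, haT]
      rw [Finset.insert_union, indepPoly_insert hr haST, indepPoly_insert hr haS,
        Finset.filter_union]
      have h := ih _ ((Finset.filter_subset (fun b => ¬ r a b) S).trans_ssubset hlt)
        (T.filter fun b => ¬ r a b)
      have h' : indepPoly r μ (S.filter fun b => ¬ r a b) *
          indepPoly r μ (T.filter fun b => ¬ r a b) ≤
          indepPoly r μ (S.filter fun b => ¬ r a b) * indepPoly r μ T :=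
        mul_le_mul_of_nonneg_left (indepPoly_mono hμ (Finset.filter_subset _ _))
          (indepPoly_pos hμ _).le
      nlinarith [mul_le_mul_of_nonneg_left (h.trans h') hμ]

theorem indepPoly_of_clique (hr : ∀ i j, r i j → r j i) (S : Finset ι)
    (hS : ∀ i ∈ S, ∀ j ∈ S, r i j) : indepPoly r μ S = 1 + μ * S.card := by
  induction S using Finset.induction_on with
  | empty => simp [indepPoly_empty]
  | insert a S ha ih =>
    have : (S.filter fun b => ¬ r a b) = ∅ := by
      rw [Finset.filter_eq_empty_iff]
      intro b hb
      simpa using hS a (by simp) b (by simp [hb])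
    rw [indepPoly_insert hr ha, this, indepPoly_empty, Finset.card_insert_of_notMem ha,
      ih fun i hi j hj => hS i (by simp [hi]) j (by simp [hj])]
    push_cast
    ring

/-- The members of `Ω` at which none of the events `A i`, `i ∈ S`, occurs. -/
def avoiding (Ω : Finset α) (A : ι → α → Prop) (S : Finset ι) : Finset α :=
  Ω.filter fun ω => ∀ i ∈ S, ¬ A i ω

/-- The cluster-expansion form of the lopsided Lovász local lemma, for the uniform measure on a
finite set. -/
theorem avoiding_nonempty {Ω : Finset α} (hΩ : Ω.Nonempty) (A : ι → α → Prop) (B : Finset ι)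
    (hr : ∀ i j, r i j → r j i) (hrefl : ∀ i ∈ B, r i i) (hμ : 0 ≤ μ) {p : ℝ} (hp : 0 ≤ p)
    (hcond : ∀ a ∈ B, p * indepPoly r μ (B.filter (r a)) ≤ μ)
    (hneg : ∀ a ∈ B, ∀ S ⊆ B, (∀ b ∈ S, ¬ r a b) →
      (((avoiding Ω A S).filter (A a)).card : ℝ) ≤ p * (avoiding Ω A S).card) :
    (avoiding Ω A B).Nonempty := by
  have hY : ∀ S, 0 < indepPoly r μ S := indepPoly_pos hμ
  have key : ∀ T ⊆ B, ∀ S ⊆ T,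
      ((avoiding Ω A S).card : ℝ) / indepPoly r μ (B \ S) ≤
        ((avoiding Ω A T).card : ℝ) / indepPoly r μ (B \ T) := by
    intro T
    induction T using Finset.strongInduction with
    | H T ih =>
      intro hTB S hST
      obtain rfl | hne := eq_or_ne S T
      · exact le_rfl
      obtain ⟨a, haT, haS⟩ := Finset.exists_of_ssubset (hST.ssubset_of_ne hne)
      obtain ⟨U, haU, rfl⟩ : ∃ U, a ∉ U ∧ insert a U = T :=
        ⟨T.erase a, by simp, Finset.insert_erase haT⟩
      have haB : a ∈ B := hTB haT
      have hUB : U ⊆ B := (Finset.subset_insert _ _).trans hTB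
      have hUlt : U ⊂ insert a U := Finset.ssubset_insert haU
      refine (ih U hUlt hUB S (by grind)).trans ?_
      set W := U.filter fun b => ¬ r a b with hW
      have hWU : W ⊆ U := Finset.filter_subset _ _
      have hstep := ih U hUlt hUB W hWU
      have hnegW := hneg a haB W (hWU.trans hUB) (by simp [hW])
      have hsplit : (avoiding Ω A U).card =
          (avoiding Ω A (insert a U)).card + ((avoiding Ω A U).filter (A a)).card := by
        rw [← Finset.card_filter_add_card_filter_not (s := avoiding Ω A U) (A a), add_comm]
        congr 2
        ext ω
        simp only [avoiding, Finset.mem_filter, Finset.mem_insert]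
        grind
      have hmono : ((avoiding Ω A U).filter (A a)).card ≤
          ((avoiding Ω A W).filter (A a)).card := by
        refine Finset.card_le_card fun ω => ?_
        simp only [avoiding, Finset.mem_filter]
        grind
      have hins : indepPoly r μ (B \ U) = indepPoly r μ (B \ insert a U) +
          μ * indepPoly r μ ((B \ insert a U).filter fun b => ¬ r a b) := by
        rw [← indepPoly_insert hr (by simp)]
        congr 1
        ext b
        simp only [Finset.mem_sdiff, Finset.mem_insert]
        clear * - haU haB
        grind
      have hunion : indepPoly r μ (B \ W) ≤
          indepPoly r μ ((B \ insert a U).filter fun b => ¬ r a b) *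
            indepPoly r μ (B.filter (r a)) := by
        refine le_trans (indepPoly_mono hμ ?_) (indepPoly_union_le hr hμ _ _)
        intro b
        have := hrefl a haB
        simp only [hW, Finset.mem_sdiff, Finset.mem_union, Finset.mem_filter, Finset.mem_insert]
        grind
      rw [div_le_div_iff₀ (hY _) (hY _)] at hstep ⊢
      set X := indepPoly r μ ((B \ insert a U).filter fun b => ¬ r a b)
      have hX : 0 < X := hY _
      have hsplit' : ((avoiding Ω A U).card : ℝ) =
          (avoiding Ω A (insert a U)).card + ((avoiding Ω A U).filter (A a)).card := by
        exact_mod_cast hsplit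
      have hmono' : (((avoiding Ω A U).filter (A a)).card : ℝ) ≤
          ((avoiding Ω A W).filter (A a)).card := by
        exact_mod_cast hmono
      have hpY : p * indepPoly r μ (B \ W) ≤ μ * X := by
        nlinarith [mul_le_mul_of_nonneg_left hunion hp,
          mul_le_mul_of_nonneg_right (hcond a haB) hX.le]
      have hbad : (((avoiding Ω A U).filter (A a)).card : ℝ) * indepPoly r μ (B \ U) ≤
          (avoiding Ω A U).card * (μ * X) :=
        calc _ ≤ p * (avoiding Ω A W).card * indepPoly r μ (B \ U) :=
              mul_le_mul_of_nonneg_right (hmono'.trans hnegW) (hY _).le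
          _ = p * ((avoiding Ω A W).card * indepPoly r μ (B \ U)) := by ring
          _ ≤ p * ((avoiding Ω A U).card * indepPoly r μ (B \ W)) :=
              mul_le_mul_of_nonneg_left hstep hp
          _ = (avoiding Ω A U).card * (p * indepPoly r μ (B \ W)) := by ring
          _ ≤ _ := mul_le_mul_of_nonneg_left hpY (Nat.cast_nonneg _)
      have h1 : ((avoiding Ω A (insert a U)).card : ℝ) =
          (avoiding Ω A U).card - ((avoiding Ω A U).filter (A a)).card := by linarith
      have h2 : indepPoly r μ (B \ insert a U) = indepPoly r μ (B \ U) - μ * X := by linarith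
      rw [h1, h2]
      nlinarith
  have h := key B subset_rfl ∅ (Finset.empty_subset _)
  have h0 : (0 : ℝ) < ((avoiding Ω A ∅).card : ℝ) / indepPoly r μ (B \ ∅) :=
    div_pos (by simpa [avoiding, Finset.card_pos] using hΩ) (hY _)
  have hpos : (0 : ℝ) < (avoiding Ω A B).card := by
    by_contra hcon
    have : ((avoiding Ω A B).card : ℝ) = 0 := le_antisymm (not_lt.1 hcon) (Nat.cast_nonneg _)
    rw [this, zero_div] at h
    linarith
  exact Finset.card_pos.1 (by exact_mod_cast hpos)

end LocalLemma

section Matchings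

variable {V : Type*}

/-- Perfect matchings of the complete graph on `V`, as fixed-point-free involutions. -/
def IsMatchingMap (f : V → V) : Prop :=
  ∀ v, f (f v) = v ∧ f v ≠ v

/-- The matching `f` with the vertices `v` and `w` exchanged. -/
def exchange (v w : V) (f : V → V) : V → V :=
  fun x => Equiv.swap v w (f (Equiv.swap v w x))

theorem exchange_exchange (v w : V) (f : V → V) : exchange v w (exchange v w f) = f := by
  funext x
  simp [exchange]

theorem IsMatchingMap.exchange {f : V → V} (hf : IsMatchingMap f) (v w : V) :
    IsMatchingMap (exchange v w f) := by
  refine fun x => ⟨by simp [PMFormal.exchange, (hf _).1], fun h => ?_⟩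
  rw [PMFormal.exchange, Equiv.swap_apply_eq_iff] at h
  exact (hf _).2 h

theorem exchange_apply_of_ne {f : V → V} {u v w : V} (huv : u ≠ v) (huw : u ≠ w) (hf : f u = v) :
    exchange v w f u = w := by
  simp [exchange, Equiv.swap_apply_of_ne_of_ne huv huw, hf]

theorem IsMatchingMap.isPM {f : V → V} (hf : IsMatchingMap f) :
    IsPM (⊤ : SimpleGraph V) {e | ∃ u, e = s(u, f u)} := by
  refine ⟨?_, fun v => ⟨s(v, f v), ⟨⟨v, rfl⟩, by simp⟩, ?_⟩⟩
  · rintro _ ⟨u, rfl⟩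
    simpa using (hf u).2.symm
  · rintro _ ⟨⟨u, rfl⟩, hv⟩
    rcases Sym2.mem_iff.1 hv with rfl | rfl
    · rfl
    · rw [(hf u).1, Sym2.eq_swap]

theorem card_mul_card_filter_le (F : Finset (V → V)) {u v : V} (huv : u ≠ v) (W : Finset V)
    (hW : u ∉ W) (h : ∀ w ∈ W, ∀ f ∈ F, f u = v → exchange v w f ∈ F) :
    W.card * (F.filter fun f => f u = v).card ≤ F.card := by
  rw [← Finset.card_product]
  refine Finset.card_le_card_of_injOn (fun x => exchange v x.1 x.2) ?_ ?_
  · rintro ⟨w, f⟩ hx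
    simp only [Finset.coe_product, Set.mem_prod, Finset.mem_coe, Finset.mem_filter] at hx
    exact h w hx.1 f hx.2.1 hx.2.2
  · rintro ⟨w, f⟩ hx ⟨w', f'⟩ hx' heq
    simp only [Finset.coe_product, Set.mem_prod, Finset.mem_coe, Finset.mem_filter] at hx hx'
    have hw : w = w' := by
      have := congrFun heq u
      simpa only [exchange_apply_of_ne huv (fun e => hW (e ▸ hx.1)) hx.2.2,
        exchange_apply_of_ne huv (fun e => hW (e ▸ hx'.1)) hx'.2.2] using this
    subst hw
    have := congrArg (exchange v w) heq
    simp only [exchange_exchange] at this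
    rw [this]

/-- All edges of `E` belong to the matching `f`. -/
def Occurs (E : Finset (Sym2 V)) (f : V → V) : Prop :=
  ∀ x y, s(x, y) ∈ E → f x = y

/-- The vertex `z` lies on some edge of `E`. -/
def Covers (E : Finset (Sym2 V)) (z : V) : Prop :=
  ∃ e ∈ E, z ∈ e

theorem occurs_of_occurs_exchange {f : V → V} (hf : IsMatchingMap f) {u v : V} (hfu : f u = v)
    {E : Finset (Sym2 V)} (hu : ¬ Covers E u) (hv : ¬ Covers E v) (w : V)
    (h : Occurs E (exchange v w f)) : Occurs E f := by
  intro x y hxy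
  have hx := h x y hxy
  have hxu : x ≠ u := fun e => hu ⟨_, hxy, by simp [e]⟩
  have hxv : x ≠ v := fun e => hv ⟨_, hxy, by simp [e]⟩
  have hyu : y ≠ u := fun e => hu ⟨_, hxy, by simp [e]⟩
  have hyv : y ≠ v := fun e => hv ⟨_, hxy, by simp [e]⟩
  have hfv : f v = u := hfu ▸ (hf u).1
  have huv : u ≠ v := fun e => (hf u).2 (hfu.trans e.symm)
  rw [exchange, Equiv.swap_apply_eq_iff] at hx
  by_cases hxw : x = w
  · subst hxw
    rw [Equiv.swap_apply_right, hfv] at hx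
    have := Equiv.swap_apply_of_ne_of_ne huv hxu.symm
    rw [hx, Equiv.swap_apply_self, ← hx] at this
    exact absurd this hyu
  · rw [Equiv.swap_apply_of_ne_of_ne hxv hxw] at hx
    by_cases hyw : y = w
    · subst hyw
      rw [Equiv.swap_apply_right] at hx
      exact absurd (by rw [← (hf x).1, hx, hfv]) hxu
    · rw [hx, Equiv.swap_apply_of_ne_of_ne hyv hyw]

/-- The dependency relation of the events `Occurs E`: the edge sets share a vertex. -/
def Meets (E E' : Finset (Sym2 V)) : Prop :=
  ∃ z, Covers E z ∧ Covers E' z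

theorem Meets.symm {E E' : Finset (Sym2 V)} : Meets E E' → Meets E' E :=
  fun ⟨z, h, h'⟩ => ⟨z, h', h⟩

theorem filter_meets_subset (B : Finset (Finset (Sym2 V))) (u v x y : V) :
    B.filter (Meets {s(u, v), s(x, y)}) ⊆
      ((B.filter fun E => Covers E u) ∪ (B.filter fun E => Covers E v)) ∪
        ((B.filter fun E => Covers E x) ∪ (B.filter fun E => Covers E y)) := by
  intro E hE
  obtain ⟨hE, z, ⟨e, he, hz⟩, hz'⟩ := Finset.mem_filter.1 hE
  simp only [Finset.mem_insert, Finset.mem_singleton] at he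
  simp only [Finset.mem_union, Finset.mem_filter]
  rcases he with rfl | rfl <;> rcases Sym2.mem_iff.1 hz with rfl | rfl <;> tauto

theorem indepPoly_filter_meets_le {B : Finset (Finset (Sym2 V))} {μ t : ℝ} (hμ : 0 ≤ μ)
    (hB : ∀ z, μ * (B.filter fun E => Covers E z).card ≤ t) (u v x y : V) :
    indepPoly Meets μ (B.filter (Meets {s(u, v), s(x, y)})) ≤ (1 + t) ^ 4 := by
  have hsymm : ∀ E E' : Finset (Sym2 V), Meets E E' → Meets E' E := fun _ _ => Meets.symm
  have hclique : ∀ z, indepPoly Meets μ (B.filter fun E => Covers E z) ≤ 1 + t := by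
    intro z
    rw [indepPoly_of_clique hsymm _ fun E hE E' hE' =>
      ⟨z, (Finset.mem_filter.1 hE).2, (Finset.mem_filter.1 hE').2⟩]
    linarith [hB z]
  have ht : 0 ≤ 1 + t := (indepPoly_pos hμ _).le.trans (hclique u)
  have hpair : ∀ z w, indepPoly Meets μ
      ((B.filter fun E => Covers E z) ∪ (B.filter fun E => Covers E w)) ≤ (1 + t) * (1 + t) :=
    fun z w => (indepPoly_union_le hsymm hμ _ _).trans
      (mul_le_mul (hclique z) (hclique w) (indepPoly_pos hμ _).le ht)
  calc _ ≤ _ := indepPoly_mono hμ (filter_meets_subset B u v x y)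
    _ ≤ _ := indepPoly_union_le hsymm hμ _ _
    _ ≤ ((1 + t) * (1 + t)) * ((1 + t) * (1 + t)) :=
      mul_le_mul (hpair u v) (hpair x y) (indepPoly_pos hμ _).le (by positivity)
    _ = (1 + t) ^ 4 := by ring

variable [Fintype V]

/-- The set of all perfect matchings. -/
def matchings (V : Type*) [Fintype V] : Finset (V → V) :=
  Finset.univ.filter IsMatchingMap

theorem mem_avoiding_matchings {S : Finset (Finset (Sym2 V))} {f : V → V} :
    f ∈ avoiding (matchings V) Occurs S ↔ IsMatchingMap f ∧ ∀ E ∈ S, ¬ Occurs E f := by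
  simp [avoiding, matchings]

theorem exchange_mem_avoiding {S : Finset (Finset (Sym2 V))} {f : V → V} {u v : V}
    (hu : ∀ E ∈ S, ¬ Covers E u) (hv : ∀ E ∈ S, ¬ Covers E v)
    (hf : f ∈ avoiding (matchings V) Occurs S) (hfu : f u = v) (w : V) :
    exchange v w f ∈ avoiding (matchings V) Occurs S := by
  rw [mem_avoiding_matchings] at hf ⊢
  exact ⟨hf.1.exchange v w, fun E hE h =>
    hf.2 E hE (occurs_of_occurs_exchange hf.1 hfu (hu E hE) (hv E hE) w h)⟩

theorem card_filter_avoiding_mul_le {S : Finset (Finset (Sym2 V))} {u v x y : V}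
    (huv : u ≠ v) (hux : u ≠ x) (huy : u ≠ y) (hvx : v ≠ x) (hvy : v ≠ y) (hxy : x ≠ y)
    (hu : ∀ E ∈ S, ¬ Covers E u) (hv : ∀ E ∈ S, ¬ Covers E v)
    (hx : ∀ E ∈ S, ¬ Covers E x) (hy : ∀ E ∈ S, ¬ Covers E y) :
    (Fintype.card V - 1) * ((Fintype.card V - 3) *
      ((avoiding (matchings V) Occurs S).filter fun f => f u = v ∧ f x = y).card) ≤
      (avoiding (matchings V) Occurs S).card := by
  set F := avoiding (matchings V) Occurs S
  have h1 := card_mul_card_filter_le F huv (Finset.univ.erase u) (by simp)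
    fun w _ f hf hfu => exchange_mem_avoiding hu hv hf hfu w
  have h2 := card_mul_card_filter_le (F.filter fun f => f u = v) hxy
    (Finset.univ \ {u, v, x}) (by simp) (by
      intro w hw f hf hfx
      simp only [Finset.mem_sdiff, Finset.mem_univ, Finset.mem_insert, Finset.mem_singleton,
        not_or, true_and] at hw
      rw [Finset.mem_filter] at hf ⊢
      refine ⟨exchange_mem_avoiding hx hy hf.1 hfx w, ?_⟩
      rw [exchange, Equiv.swap_apply_of_ne_of_ne huy (Ne.symm hw.1), hf.2,
        Equiv.swap_apply_of_ne_of_ne hvy (Ne.symm hw.2.1)])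
  rw [Finset.card_erase_of_mem (Finset.mem_univ _), Finset.card_univ] at h1
  rw [Finset.card_sdiff_of_subset (Finset.subset_univ _), Finset.card_univ,
    Finset.card_eq_three.2 ⟨u, v, x, huv, hux, hvx, rfl⟩, Finset.filter_filter] at h2
  exact (Nat.mul_le_mul_left _ h2).trans h1

theorem matchings_nonempty_of_isMatchingMap {f : V → V} (hf : IsMatchingMap f) :
    (matchings V).Nonempty :=
  ⟨f, by simpa [matchings] using hf⟩

/-- The pairs of disjoint edges with the same color. -/
def conflicts {C : Type*} (c : Sym2 V → C) : Finset (Finset (Sym2 V)) :=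
  Finset.univ.filter fun E => ∃ u v x y : V, u ≠ v ∧ u ≠ x ∧ u ≠ y ∧ v ≠ x ∧ v ≠ y ∧ x ≠ y ∧
    c s(u, v) = c s(x, y) ∧ E = {s(u, v), s(x, y)}

theorem card_conflicts_covering_le {C : Type*} (c : Sym2 V → C) {q : ℕ}
    (hq : ∀ k, {e : Sym2 V | ¬ e.IsDiag ∧ c e = k}.ncard ≤ q) (z : V) :
    ((conflicts c).filter fun E => Covers E z).card ≤ (Fintype.card V - 1) * q := by
  have hsub : ((conflicts c).filter fun E => Covers E z) ⊆
      (Finset.univ.erase z).biUnion fun y =>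
        (Finset.univ.filter fun e : Sym2 V => ¬ e.IsDiag ∧ c e = c s(z, y)).image
          fun e => {s(z, y), e} := by
    intro E hE
    simp only [conflicts, Finset.mem_filter, Finset.mem_univ, true_and] at hE
    obtain ⟨⟨u, v, x, y, huv, hux, huy, hvx, hvy, hxy, hc, rfl⟩, e, he, hz⟩ := hE
    simp only [Finset.mem_biUnion, Finset.mem_erase, Finset.mem_univ, and_true,
      Finset.mem_image, Finset.mem_filter, true_and]
    simp only [Finset.mem_insert, Finset.mem_singleton] at he
    rcases he with rfl | rfl <;> rcases Sym2.mem_iff.1 hz with rfl | rfl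
    · exact ⟨v, huv.symm, s(x, y), ⟨by simpa using hxy, hc.symm⟩, rfl⟩
    · exact ⟨u, huv, s(x, y), ⟨by simpa using hxy, by rw [← hc, Sym2.eq_swap]⟩,
        by rw [Sym2.eq_swap]⟩
    · exact ⟨y, hxy.symm, s(u, v), ⟨by simpa using huv, hc⟩, Finset.pair_comm _ _⟩
    · exact ⟨x, hxy, s(u, v), ⟨by simpa using huv, by rw [hc, Sym2.eq_swap]⟩,
        by rw [Finset.pair_comm, Sym2.eq_swap (a := x)]⟩
  refine (Finset.card_le_card hsub).trans ?_
  rw [← Finset.card_univ, ← Finset.card_erase_of_mem (Finset.mem_univ z)]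
  refine Finset.card_biUnion_le_card_mul _ _ _ fun y _ => Finset.card_image_le.trans ?_
  have h := hq (c s(z, y))
  rwa [Set.ncard_eq_toFinset_card', Set.toFinset_ofPred] at h

theorem card_filter_occurs_mul_le {C : Type*} (c : Sym2 V → C) {E : Finset (Sym2 V)}
    (hE : E ∈ conflicts c) {S : Finset (Finset (Sym2 V))} (hS : ∀ E' ∈ S, ¬ Meets E E') :
    (Fintype.card V - 1) * ((Fintype.card V - 3) *
      ((avoiding (matchings V) Occurs S).filter (Occurs E)).card) ≤
      (avoiding (matchings V) Occurs S).card := by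
  obtain ⟨u, v, x, y, huv, hux, huy, hvx, hvy, hxy, -, rfl⟩ := (Finset.mem_filter.1 hE).2
  have hdisj : ∀ e ∈ ({s(u, v), s(x, y)} : Finset (Sym2 V)), ∀ z ∈ e, ∀ E ∈ S,
      ¬ Covers E z := fun e he z hz E hES h => hS E hES ⟨z, ⟨e, he, hz⟩, h⟩
  refine le_trans ?_ (card_filter_avoiding_mul_le huv hux huy hvx hvy hxy
    (hdisj s(u, v) (by simp) u (by simp)) (hdisj s(u, v) (by simp) v (by simp))
    (hdisj s(x, y) (by simp) x (by simp)) (hdisj s(x, y) (by simp) y (by simp)))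
  exact Nat.mul_le_mul_left _ (Nat.mul_le_mul_left _ (Finset.card_le_card
    (Finset.monotone_filter_right _ fun f _ h => ⟨h u v (by simp), h x y (by simp)⟩)))

theorem exists_rainbow_matchingMap {C : Type*} (c : Sym2 V → C) {n : ℕ} (hn : 400 ≤ n)
    (hV : Fintype.card V = 2 * n) (hne : (matchings V).Nonempty)
    (hq : ∀ k, {e : Sym2 V | ¬ e.IsDiag ∧ c e = k}.ncard ≤ ⌊(0.21 : ℝ) * (n : ℝ)⌋₊) :
    ∃ f : V → V, IsMatchingMap f ∧ ∀ E ∈ conflicts c, ¬ Occurs E f := by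
  have hn' : (400 : ℝ) ≤ n := by exact_mod_cast hn
  have h1 : (0 : ℝ) < 2 * n - 1 := by linarith
  have h3 : (0 : ℝ) < 2 * n - 3 := by linarith
  have h0 : (0 : ℝ) < n := by linarith
  obtain ⟨μ, hμ⟩ : ∃ μ : ℝ, μ = 1 / (3 * ((2 * n - 1) * (0.21 * n))) := ⟨_, rfl⟩
  obtain ⟨p, hp⟩ : ∃ p : ℝ, p = 1 / ((2 * n - 1) * (2 * n - 3)) := ⟨_, rfl⟩
  have hμ0 : 0 < μ := by rw [hμ]; positivity
  have hp0 : 0 < p := by rw [hp]; positivity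
  have hcast1 : ((2 * n - 1 : ℕ) : ℝ) = 2 * n - 1 := by
    rw [Nat.cast_sub (by omega)]; push_cast; ring
  have hcast3 : ((2 * n - 3 : ℕ) : ℝ) = 2 * n - 3 := by
    rw [Nat.cast_sub (by omega)]; push_cast; ring
  have hclique : ∀ z, μ * (((conflicts c).filter fun E => Covers E z).card : ℝ) ≤ 1 / 3 := by
    intro z
    have h := (Nat.cast_le (α := ℝ)).2 (card_conflicts_covering_le c hq z)
    rw [hV, Nat.cast_mul, hcast1] at h
    calc _ ≤ μ * ((2 * n - 1) * (0.21 * n)) := mul_le_mul_of_nonneg_left (h.trans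
          (mul_le_mul_of_nonneg_left (Nat.floor_le (by positivity)) h1.le)) hμ0.le
      _ = 1 / 3 := by rw [hμ]; field_simp
  have hnum : p * (1 + 1 / 3) ^ 4 ≤ μ := by
    rw [hp, hμ, div_mul_eq_mul_div, div_le_div_iff₀ (by positivity) (by positivity)]
    have : 0 ≤ (2 * (n : ℝ) - 1) * ((2 * n - 3) - (4 / 3) ^ 4 * (3 * (0.21 * n))) :=
      mul_nonneg h1.le (by norm_num; linarith)
    nlinarith
  obtain ⟨f, hf⟩ := avoiding_nonempty (r := Meets) hne Occurs (conflicts c)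
    (fun _ _ => Meets.symm)
    (by
      intro E hE
      obtain ⟨u, v, x, y, -, -, -, -, -, -, -, rfl⟩ := (Finset.mem_filter.1 hE).2
      exact ⟨u, ⟨s(u, v), by simp, by simp⟩, ⟨s(u, v), by simp, by simp⟩⟩)
    hμ0.le hp0.le
    (by
      intro E hE
      obtain ⟨u, v, x, y, -, -, -, -, -, -, -, rfl⟩ := (Finset.mem_filter.1 hE).2
      exact (mul_le_mul_of_nonneg_left (indepPoly_filter_meets_le hμ0.le hclique u v x y)
        hp0.le).trans hnum)
    (by
      intro E hE S _ hS
      have h := (Nat.cast_le (α := ℝ)).2 (card_filter_occurs_mul_le c hE hS)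
      rw [hV, Nat.cast_mul, Nat.cast_mul, hcast1, hcast3] at h
      rw [hp, div_mul_eq_mul_div, le_div_iff₀ (by positivity)]
      linarith)
  exact ⟨f, mem_avoiding_matchings.1 hf⟩

theorem IsMatchingMap.injOn_color {C : Type*} {c : Sym2 V → C} {f : V → V} (hf : IsMatchingMap f)
    (h : ∀ E ∈ conflicts c, ¬ Occurs E f) : Set.InjOn c {e | ∃ u, e = s(u, f u)} := by
  rintro _ ⟨u, rfl⟩ _ ⟨x, rfl⟩ hc
  by_contra hne
  have hux : u ≠ x := fun e => hne (by rw [e])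
  have hufx : u ≠ f x := fun e => hne (by rw [e, (hf x).1, Sym2.eq_swap])
  have hfux : f u ≠ x := fun e => hufx (by rw [← e, (hf u).1])
  have hff : f u ≠ f x := fun e => hux (by rw [← (hf u).1, e, (hf x).1])
  refine h {s(u, f u), s(x, f x)} (Finset.mem_filter.2 ⟨Finset.mem_univ _, u, f u, x, f x,
    (hf u).2.symm, hux, hufx, hfux, hff, (hf x).2.symm, hc, rfl⟩) fun a b hab => ?_
  simp only [Finset.mem_insert, Finset.mem_singleton, Sym2.eq_iff] at hab
  rcases hab with (⟨rfl, rfl⟩ | ⟨rfl, rfl⟩) | (⟨rfl, rfl⟩ | ⟨rfl, rfl⟩)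
  exacts [rfl, (hf _).1, rfl, (hf _).1]

end Matchings

/-- there is `n₀` such that for all `n ≥ n₀`, every edge coloring of the
complete graph on `2n` vertices using each color on at most `⌊0.21 n⌋` edges admits a
rainbow perfect matching. -/
theorem stmt_19 :
    ∃ n0 : ℕ, ∀ n : ℕ, n0 ≤ n → ∀ (C : Type) (c : Sym2 (Fin (2 * n)) → C),
      (∀ k : C, {e : Sym2 (Fin (2 * n)) | ¬ e.IsDiag ∧ c e = k}.ncard ≤
        ⌊(0.21 : ℝ) * (n : ℝ)⌋₊) →
      ∃ M : Set (Sym2 (Fin (2 * n))),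
        IsPM (⊤ : SimpleGraph (Fin (2 * n))) M ∧ Set.InjOn c M := by
  refine ⟨400, fun n hn C c hq => ?_⟩
  have hne : (matchings (Fin (2 * n))).Nonempty := by
    refine matchings_nonempty_of_isMatchingMap (f := Fin.rev) fun v => ⟨Fin.rev_rev v, fun h => ?_⟩
    have := congrArg Fin.val h
    rw [Fin.val_rev] at this
    omega
  obtain ⟨f, hf, hfc⟩ := exists_rainbow_matchingMap c hn (by simp) hne hq
  exact ⟨{e | ∃ u, e = s(u, f u)}, hf.isPM, hf.injOn_color hfc⟩

end PMFormal
end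
end
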